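/- arXiv:1302.5984 — 2 statements merged into one kernel-verified Lean document; each statement's English description precedes it below -/
import Mathlib

section
/- The series ∑_{n=0}^∞ C(2n,n)² · P_n(2√2/3) · (3√2/128)^n · (6n + 1) converges to 2√(8 + 6√2)/π. -/
open Real Filter

/-- The Legendre polynomial of degree `n`, given by the explicit formula
`P_n(x) = 2^{-n} ∑_{j=0}^{n} C(n,j)^2 (x-1)^{n-j} (x+1)^j`. -/
noncomputable def legendreP (n : ℕ) (x : ℝ) : ℝ :=
  (2 : ℝ)⁻¹ ^ n *
    ∑ j ∈ Finset.range (n + 1), (n.choose j : ℝ) ^ 2 * (x - 1) ^ (n - j) * (x + 1) ^ j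

/-- The sum of the power series with coefficients `c`. -/
noncomputable def powerSum (c : ℕ → ℝ) (x : ℝ) : ℝ := ∑' n, c n * x ^ n

/-- The coefficients of the derivative of a power series. -/
def derivCoeff (c : ℕ → ℝ) (n : ℕ) : ℝ := (n + 1) * c (n + 1)

/-- The power series with coefficients `c` converges absolutely on `(-R, R)`. -/
def AbsConv (R : ℝ) (c : ℕ → ℝ) : Prop :=
  ∀ r, 0 ≤ r → r < R → Summable fun n => |c n| * r ^ n

theorem AbsConv.summable {R : ℝ} {c : ℕ → ℝ} (h : AbsConv R c) {x : ℝ} (hx : |x| < R) :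
    Summable fun n => c n * x ^ n := by
  refine Summable.of_norm ?_
  simpa [abs_mul, abs_pow] using h |x| (abs_nonneg x) hx

theorem AbsConv.summable_mul {R : ℝ} {c : ℕ → ℝ} (h : AbsConv R c) {r : ℝ} (h0 : 0 < r)
    (hr : r < R) : Summable fun n : ℕ => (n : ℝ) * |c n| * r ^ (n - 1) := by
  obtain ⟨s, hrs, hsR⟩ := exists_between hr
  have hs : 0 < s := h0.trans hrs
  have hsum := h s hs.le hsR
  obtain ⟨M, hM⟩ := hsum.tendsto_atTop_zero.bddAbove_range
  have hM' : ∀ n, |c n| * s ^ n ≤ M := fun n => hM ⟨n, rfl⟩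
  have hq : ‖r / s‖ < 1 := by
    rw [Real.norm_eq_abs, abs_of_pos (by positivity)]
    exact (div_lt_one hs).2 hrs
  have h1 := (summable_pow_mul_geometric_of_norm_lt_one (R := ℝ) 1 hq).mul_left (M / r)
  refine Summable.of_nonneg_of_le (fun n => by positivity) (fun n => ?_) h1
  rcases n with _ | n
  · simp
  · have h2 := hM' (n + 1)
    have e : ((n + 1 : ℕ) : ℝ) * |c (n + 1)| * r ^ (n + 1 - 1)
        = (|c (n + 1)| * s ^ (n + 1)) * (((n + 1 : ℕ) : ℝ) * (r / s) ^ (n + 1) / r) := by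
      rw [Nat.add_sub_cancel, div_pow, pow_succ r]; field_simp
    rw [e]
    calc _ ≤ M * (((n + 1 : ℕ) : ℝ) * (r / s) ^ (n + 1) / r) := by gcongr
      _ = _ := by rw [pow_one]; ring

theorem AbsConv.derivCoeff {R : ℝ} {c : ℕ → ℝ} (h : AbsConv R c) :
    AbsConv R (derivCoeff c) := by
  intro r h0 hr
  obtain ⟨s, hrs, hsR⟩ := exists_between hr
  have h1 := (summable_nat_add_iff 1).2 (h.summable_mul (h0.trans_lt hrs) hsR)
  refine Summable.of_nonneg_of_le (fun n => by positivity) (fun n => ?_) h1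
  have : |_root_.derivCoeff c n| = ((n + 1 : ℕ) : ℝ) * |c (n + 1)| := by
    rw [_root_.derivCoeff, abs_mul, abs_of_nonneg (by positivity)]; push_cast; rfl
  rw [this, Nat.add_sub_cancel]
  gcongr

theorem AbsConv.hasDerivAt {R : ℝ} {c : ℕ → ℝ} (h : AbsConv R c) {x : ℝ} (hx : |x| < R) :
    HasDerivAt (powerSum c) (powerSum (_root_.derivCoeff c) x) x := by
  obtain ⟨r, hxr, hrR⟩ := exists_between hx
  have h0 : 0 < r := (abs_nonneg x).trans_lt hxr
  have hsum := h.summable_mul h0 hrR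
  have hball : ∀ {y : ℝ}, y ∈ Metric.ball (0 : ℝ) r ↔ |y| < r := by simp
  have key := hasDerivAt_tsum_of_isPreconnected (𝕜 := ℝ) (g := fun n y => c n * y ^ n)
    (g' := fun n y => c n * (n * y ^ (n - 1))) (y₀ := 0) (y := x) hsum Metric.isOpen_ball
    (convex_ball (0 : ℝ) r).isPreconnected
    (fun n y _ => (hasDerivAt_pow n y).const_mul (c n))
    (fun n y hy => ?_) (hball.2 (by simpa using h0))
    (h.summable (by simpa using h0.trans hrR)) (hball.2 hxr)
  · convert! key using 1
    have hs : Summable fun n : ℕ => c n * (n * x ^ (n - 1)) := by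
      refine Summable.of_norm_bounded hsum fun n => ?_
      rw [norm_mul, norm_mul, norm_pow, Real.norm_eq_abs, Real.norm_natCast, Real.norm_eq_abs,
        mul_left_comm, mul_assoc]
      gcongr
    rw [hs.tsum_eq_zero_add, powerSum]
    simp only [_root_.derivCoeff, Nat.cast_zero, zero_mul, mul_zero, zero_add, Nat.add_sub_cancel]
    exact tsum_congr fun n => by push_cast; ring
  · rw [norm_mul, norm_mul, norm_pow, Real.norm_eq_abs, Real.norm_natCast, Real.norm_eq_abs,
      mul_left_comm, mul_assoc]
    have := (hball.1 hy).le
    gcongr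

theorem AbsConv.hasSum_natCast_mul {R : ℝ} {c : ℕ → ℝ} (h : AbsConv R c) {x : ℝ}
    (hx : |x| < R) :
    HasSum (fun n : ℕ => n * c n * x ^ n) (x * powerSum (_root_.derivCoeff c) x) := by
  have h1 := ((h.derivCoeff.summable hx).hasSum.mul_left x)
  rw [← hasSum_nat_add_iff' 1]
  simp only [Finset.sum_range_one, Nat.cast_zero, zero_mul, sub_zero]
  convert! h1 using 1
  funext n
  simp only [_root_.derivCoeff]
  push_cast; ring

/-- The coefficients of `2F1(1/2, 1/2; 1; m) = (2/π) K(m)`. -/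
noncomputable def ellCoeff (n : ℕ) : ℝ := ((n.centralBinom : ℝ) / 4 ^ n) ^ 2

theorem ellCoeff_zero : ellCoeff 0 = 1 := by simp [ellCoeff]

theorem ellCoeff_pos (n : ℕ) : 0 < ellCoeff n := by
  have := Nat.centralBinom_pos n
  unfold ellCoeff
  positivity

theorem ellCoeff_succ (n : ℕ) :
    ((n : ℝ) + 1) ^ 2 * ellCoeff (n + 1) = (n + 1 / 2) ^ 2 * ellCoeff n := by
  have h : ((n : ℝ) + 1) * (n + 1).centralBinom = 2 * (2 * n + 1) * n.centralBinom := by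
    exact_mod_cast Nat.succ_mul_centralBinom_succ n
  calc _ = (((n : ℝ) + 1) * (n + 1).centralBinom / 4 ^ (n + 1)) ^ 2 := by
        unfold ellCoeff; ring
    _ = _ := by rw [h, ellCoeff, pow_succ]; field_simp; ring

theorem ellCoeff_le_one (n : ℕ) : ellCoeff n ≤ 1 := by
  induction n with
  | zero => simp [ellCoeff_zero]
  | succ n ih =>
    have h := ellCoeff_succ n
    have h1 := ellCoeff_pos (n + 1)
    have h2 := ellCoeff_pos n
    have h3 : (0 : ℝ) ≤ n := n.cast_nonneg
    have h4 : ((n : ℝ) + 1 / 2) ^ 2 * ellCoeff n ≤ (n + 1) ^ 2 * 1 := by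
      gcongr; norm_num
    rw [← h] at h4
    exact le_of_mul_le_mul_left h4 (by positivity)

theorem absConv_ellCoeff : AbsConv 1 ellCoeff := by
  intro r h0 h1
  refine Summable.of_nonneg_of_le (fun n => by positivity) (fun n => ?_)
    (summable_geometric_of_lt_one h0 h1)
  rw [abs_of_pos (ellCoeff_pos n)]
  exact mul_le_of_le_one_left (by positivity) (ellCoeff_le_one n)

/-- The normalized complete elliptic integral of the first kind `(2/π) K` as a function of the
parameter. -/
noncomputable def ellK : ℝ → ℝ := powerSum ellCoeff

/-- The derivative of `ellK`. -/
noncomputable def ellK' : ℝ → ℝ := powerSum (derivCoeff ellCoeff)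

/-- The second derivative of `ellK`. -/
noncomputable def ellK'' : ℝ → ℝ := powerSum (derivCoeff (derivCoeff ellCoeff))

theorem hasDerivAt_ellK {m : ℝ} (hm : |m| < 1) : HasDerivAt ellK (ellK' m) m :=
  absConv_ellCoeff.hasDerivAt hm

theorem hasDerivAt_ellK' {m : ℝ} (hm : |m| < 1) : HasDerivAt ellK' (ellK'' m) m :=
  absConv_ellCoeff.derivCoeff.hasDerivAt hm

theorem ellK_zero : ellK 0 = 1 := by
  rw [ellK, powerSum, tsum_eq_single 0 (by intro n hn; simp [hn])]
  simp [ellCoeff_zero]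

theorem ellK_pos {m : ℝ} (h0 : 0 ≤ m) (h1 : m < 1) : 0 < ellK m := by
  have hs := absConv_ellCoeff.summable (x := m) (by rwa [abs_of_nonneg h0])
  refine hs.tsum_pos (fun n => mul_nonneg (ellCoeff_pos n).le (by positivity)) 0 ?_
  simp [ellCoeff_zero]

theorem ellK_ode {m : ℝ} (hm : |m| < 1) :
    m * (1 - m) * ellK'' m + (1 - 2 * m) * ellK' m = ellK m / 4 := by
  have h0 := (absConv_ellCoeff.summable hm).hasSum
  have h1 := (absConv_ellCoeff.derivCoeff.summable hm).hasSum
  have h2 := absConv_ellCoeff.hasSum_natCast_mul hm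
  have h3 := absConv_ellCoeff.derivCoeff.hasSum_natCast_mul hm
  have h4 : HasSum (fun n : ℕ => (n : ℝ) * (n - 1) * ellCoeff n * m ^ n)
      (m * (m * ellK'' m)) := by
    rw [← hasSum_nat_add_iff' 1]
    simp only [Finset.sum_range_one, Nat.cast_zero, zero_mul, sub_zero]
    convert! h3.mul_left m using 1
    funext n
    simp only [derivCoeff]
    push_cast; ring
  have h5 := (((h3.sub h4).add h1).sub (h2.mul_left 2)).sub (h0.mul_left (1 / 4))
  have h6 := h5.unique ((hasSum_zero (α := ℝ)).congr_fun fun n => by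
    simp only [derivCoeff]
    linear_combination (m ^ n) * ellCoeff_succ n)
  change m * ellK'' m - m * (m * ellK'' m) + ellK' m - 2 * (m * ellK' m)
    - 1 / 4 * ellK m = 0 at h6
  linear_combination h6

theorem ellCoeff_mul_W (n : ℕ) : ellCoeff n * Real.Wallis.W n * (2 * n + 1) = 1 := by
  induction n with
  | zero => simp [ellCoeff_zero, Real.Wallis.W]
  | succ n ih =>
    have h := ellCoeff_succ n
    have h1 : ellCoeff (n + 1) = (n + 1 / 2) ^ 2 * ellCoeff n / ((n : ℝ) + 1) ^ 2 := by
      rw [← h]; field_simp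
    rw [Real.Wallis.W_succ, h1]
    push_cast
    have h2 : (2 * (n : ℝ) + 2) ≠ 0 := by positivity
    have h3 : (2 * (n : ℝ) + 3) ≠ 0 := by positivity
    have h4 : (2 * (n : ℝ) + 1) ≠ 0 := by positivity
    have h5 : ((n : ℝ) + 1) ≠ 0 := by positivity
    calc _ = ellCoeff n * Real.Wallis.W n * (2 * n + 1) := by field_simp; ring
      _ = 1 := ih

theorem tendsto_succ_mul_ellCoeff :
    Tendsto (fun n : ℕ => ((n : ℝ) + 1) * ellCoeff (n + 1)) atTop (nhds (1 / π)) := by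
  have h1 : Tendsto (fun n : ℕ => (n : ℝ) / (n + (1 / 2 : ℝ))) atTop (nhds 1) :=
    tendsto_natCast_div_add_atTop (1 / 2 : ℝ)
  have h2 := (Real.Wallis.tendsto_W_nhds_pi_div_two.inv₀ (by positivity)).mul h1
  have h3 : Tendsto (fun n : ℕ => (n : ℝ) * ellCoeff n) atTop (nhds (1 / π)) := by
    have e : (1 / π) = (π / 2)⁻¹ * 1 * (1 / 2) := by field_simp
    rw [e]
    refine (h2.mul_const (1 / 2)).congr fun n => ?_
    have h := ellCoeff_mul_W n
    have hW := (Real.Wallis.W_pos n).ne'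
    have h4 : (2 * (n : ℝ) + 1) ≠ 0 := by positivity
    have h5 : ellCoeff n = 1 / (Real.Wallis.W n * (2 * n + 1)) := by
      rw [eq_div_iff (mul_ne_zero hW h4)]; linear_combination h
    rw [h5]
    have h6 : (n : ℝ) + 1 / 2 ≠ 0 := by positivity
    field_simp
  have := (tendsto_add_atTop_iff_nat 1).2 h3
  simpa using this

theorem tendsto_ellCoeff : Tendsto ellCoeff atTop (nhds 0) := by
  rw [← tendsto_add_atTop_iff_nat 1]
  have h := tendsto_succ_mul_ellCoeff.mul (tendsto_one_div_add_atTop_nhds_zero_nat (𝕜 := ℝ))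
  rw [mul_zero] at h
  refine h.congr fun n => ?_
  have : (n : ℝ) + 1 ≠ 0 := by positivity
  field_simp

/-- An Abelian theorem: if `c n → L` then `(1 - x) ∑ c n x ^ n → L` as `x → 1⁻`. -/
theorem AbsConv.tendsto_one_sub_mul_powerSum {c : ℕ → ℝ} (h : AbsConv 1 c) {L : ℝ}
    (hc : Tendsto c atTop (nhds L)) :
    Tendsto (fun x => (1 - x) * powerSum c x) (nhdsWithin 1 (Set.Iio 1)) (nhds L) := by
  let d : ℕ → ℝ := fun n => c n - (if n = 0 then 0 else c (n - 1))
  have hd : ∀ n, ∑ i ∈ Finset.range (n + 1), d i = c n := by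
    intro n
    induction n with
    | zero => simp [d]
    | succ n ih => rw [Finset.sum_range_succ, ih]; simp [d]
  have h1 : Tendsto (fun n => ∑ i ∈ Finset.range n, d i) atTop (nhds L) := by
    rw [← tendsto_add_atTop_iff_nat 1]
    exact hc.congr fun n => (hd n).symm
  refine (Real.tendsto_tsum_powerSeries_nhdsWithin_lt h1).congr' ?_
  filter_upwards [Ioo_mem_nhdsLT (show (0 : ℝ) < 1 by norm_num)] with x hx
  have hs := h.summable (x := x) (by rw [abs_of_pos hx.1]; exact hx.2)
  have h2 : HasSum (fun n => (if n = 0 then 0 else c (n - 1)) * x ^ n) (x * powerSum c x) := by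
    rw [← hasSum_nat_add_iff' 1]
    simp only [Finset.sum_range_one, if_true, zero_mul, sub_zero]
    convert! hs.hasSum.mul_left x using 1
    funext n
    simp only [Nat.add_sub_cancel, Nat.succ_ne_zero, if_false]
    ring
  have h3 := hs.hasSum.sub h2
  rw [show (1 - x) * powerSum c x = powerSum c x - x * powerSum c x by ring]
  refine Eq.trans ?_ h3.tsum_eq
  exact tsum_congr fun n => by simp only [d]; ring

/-- Legendre's relation at the lemniscatic modulus. -/
theorem ellK_half_mul_ellK'_half : ellK (1 / 2) * ellK' (1 / 2) = 2 / π := by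
  let V : ℝ → ℝ := fun m => m * (1 - m) * (ellK' m * ellK (1 - m) + ellK m * ellK' (1 - m))
  have hV : ∀ m ∈ Set.Ioo (0 : ℝ) 1, HasDerivAt V 0 m := by
    intro m hm
    have ha : |m| < 1 := by rw [abs_of_pos hm.1]; exact hm.2
    have hb : |1 - m| < 1 := by
      rw [abs_of_pos (by linarith [hm.2])]; linarith [hm.1]
    have hi : HasDerivAt (fun m : ℝ => 1 - m) (-1) m := by
      simpa using (hasDerivAt_id m).const_sub 1
    have d1 := hasDerivAt_ellK ha
    have d2 := hasDerivAt_ellK' ha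
    have d3 := (hasDerivAt_ellK hb).comp m hi
    have d4 := (hasDerivAt_ellK' hb).comp m hi
    have d := ((hasDerivAt_id m).mul hi).mul ((d2.mul d3).add (d1.mul d4))
    convert! d using 1
    simp only [Pi.mul_apply, Pi.add_apply, Function.comp_apply, id]
    linear_combination (-ellK (1 - m)) * ellK_ode ha + ellK m * ellK_ode hb
  have hconst : ∀ m ∈ Set.Ioo (0 : ℝ) 1, V m = V (1 / 2) := fun m hm =>
    isOpen_Ioo.is_const_of_deriv_eq_zero isPreconnected_Ioo
      (fun x hx => (hV x hx).differentiableAt.differentiableWithinAt)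
      (fun x hx => (hV x hx).deriv) hm ⟨by norm_num, by norm_num⟩
  have hrefl : Tendsto (fun m : ℝ => 1 - m) (nhdsWithin 0 (Set.Ioi 0))
      (nhdsWithin 1 (Set.Iio 1)) := by
    refine tendsto_nhdsWithin_iff.2 ⟨?_, ?_⟩
    · have : Tendsto (fun m : ℝ => 1 - m) (nhds 0) (nhds (1 - 0)) := by
        exact (continuous_const.sub continuous_id).tendsto 0
      rw [sub_zero] at this
      exact this.mono_left nhdsWithin_le_nhds
    · filter_upwards [self_mem_nhdsWithin] with m hm
      simpa using hm
  have t1 := (absConv_ellCoeff.tendsto_one_sub_mul_powerSum tendsto_ellCoeff).comp hrefl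
  have t2 := (absConv_ellCoeff.derivCoeff.tendsto_one_sub_mul_powerSum
    tendsto_succ_mul_ellCoeff).comp hrefl
  have c1 : Tendsto ellK (nhdsWithin 0 (Set.Ioi 0)) (nhds (ellK 0)) :=
    (hasDerivAt_ellK (by simp)).continuousAt.tendsto.mono_left nhdsWithin_le_nhds
  have c2 : Tendsto ellK' (nhdsWithin 0 (Set.Ioi 0)) (nhds (ellK' 0)) :=
    (hasDerivAt_ellK' (by simp)).continuousAt.tendsto.mono_left nhdsWithin_le_nhds
  have c3 := hrefl.mono_right nhdsWithin_le_nhds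
  have hlim := c3.mul ((c2.mul t1).add (c1.mul t2))
  rw [ellK_zero, mul_zero, zero_add, one_mul, one_mul] at hlim
  have hlim' : Tendsto (fun _ : ℝ => V (1 / 2)) (nhdsWithin 0 (Set.Ioi 0)) (nhds (1 / π)) := by
    refine hlim.congr' ?_
    filter_upwards [Ioo_mem_nhdsGT (show (0 : ℝ) < 1 by norm_num)] with m hm
    rw [← hconst m hm]
    simp only [V, Function.comp_apply, ellK, ellK']
    ring
  have h := tendsto_nhds_unique tendsto_const_nhds hlim'
  simp only [V] at h
  rw [show (1 : ℝ) - 1 / 2 = 1 / 2 by norm_num] at h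
  linear_combination 2 * h

/-- The Wronskian-type quantity whose vanishing encodes the Landen transformation. -/
noncomputable def landenWronskian (s : ℝ) : ℝ :=
  (1 - s ^ 4) * (-4 * s ^ 3 * (ellK' (1 - s ^ 4) * ellK (-(1 - s ^ 2) ^ 2 / (4 * s ^ 2)))
    - (1 - s ^ 4) / (2 * s ^ 3) * (ellK (1 - s ^ 4) * ellK' (-(1 - s ^ 2) ^ 2 / (4 * s ^ 2)))
    + ellK (1 - s ^ 4) * ellK (-(1 - s ^ 2) ^ 2 / (4 * s ^ 2)) / s)

theorem abs_one_sub_pow_four_lt {s : ℝ} (h0 : 0 < s) (h1 : s ≤ 1) : |1 - s ^ 4| < 1 := by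
  have : s ^ 4 ≤ 1 := pow_le_one₀ h0.le h1
  rw [abs_of_nonneg (by linarith)]
  linarith [pow_pos h0 4]

theorem abs_landenArg_lt {s : ℝ} (h0 : 0 < s) (h1 : s ≤ 1) (h4 : 1 / 2 ≤ s ^ 4) :
    |-(1 - s ^ 2) ^ 2 / (4 * s ^ 2)| < 1 := by
  have : s ^ 2 ≤ 1 := pow_le_one₀ h0.le h1
  have h2 : 1 / 2 ≤ s ^ 2 := by nlinarith [sq_nonneg (s ^ 2)]
  rw [abs_div, abs_neg, abs_of_nonneg (sq_nonneg _), abs_of_pos (by positivity),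
    div_lt_one (by positivity)]
  nlinarith

theorem hasDerivAt_one_sub_pow_four (s : ℝ) :
    HasDerivAt (fun s : ℝ => 1 - s ^ 4) (-(4 * s ^ 3)) s := by
  simpa using (hasDerivAt_pow 4 s).const_sub 1

theorem hasDerivAt_landenArg {s : ℝ} (h0 : 0 < s) :
    HasDerivAt (fun s : ℝ => -(1 - s ^ 2) ^ 2 / (4 * s ^ 2)) ((1 - s ^ 4) / (2 * s ^ 3)) s := by
  have d := ((((hasDerivAt_pow 2 s).const_sub 1).pow 2).neg).div
    ((hasDerivAt_pow 2 s).const_mul 4) (by positivity)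
  convert! d using 1
  simp
  field_simp
  ring

theorem landenWronskian_eq_zero {s : ℝ} (h0 : 0 < s) (h1 : s ≤ 1) (h4 : 1 / 2 ≤ s ^ 4) :
    landenWronskian s = 0 := by
  have hd : ∀ t ∈ Set.Icc s 1, HasDerivAt landenWronskian 0 t := by
    intro t ht
    have t0 : 0 < t := h0.trans_le ht.1
    have t4 : 1 / 2 ≤ t ^ 4 := h4.trans (pow_le_pow_left₀ h0.le ht.1 4)
    have hb := abs_one_sub_pow_four_lt t0 ht.2
    have ha := abs_landenArg_lt t0 ht.2 t4
    have db := hasDerivAt_one_sub_pow_four t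
    have da := hasDerivAt_landenArg t0
    have f0 := (hasDerivAt_ellK hb).comp t db
    have f1 := (hasDerivAt_ellK' hb).comp t db
    have g0 := (hasDerivAt_ellK ha).comp t da
    have g1 := (hasDerivAt_ellK' ha).comp t da
    have d := db.mul (((((hasDerivAt_pow 3 t).const_mul (-4)).mul (f1.mul g0)).sub
      ((db.div ((hasDerivAt_pow 3 t).const_mul 2) (by positivity)).mul (f0.mul g1))).add
      ((f0.mul g0).div (hasDerivAt_id t) t0.ne'))
    convert! d using 1
    have o1 := ellK_ode hb
    have o2 := ellK_ode ha
    simp only [Pi.mul_apply, Pi.add_apply, Pi.sub_apply, Pi.div_apply, Function.comp_apply, id]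
    generalize ellK (1 - t ^ 4) = F0 at *
    generalize ellK' (1 - t ^ 4) = F1 at *
    generalize ellK'' (1 - t ^ 4) = F2 at *
    generalize ellK (-(1 - t ^ 2) ^ 2 / (4 * t ^ 2)) = G0 at *
    generalize ellK' (-(1 - t ^ 2) ^ 2 / (4 * t ^ 2)) = G1 at *
    generalize ellK'' (-(1 - t ^ 2) ^ 2 / (4 * t ^ 2)) = G2 at *
    clear f0 f1 g0 g1 d ha hb
    have ht := t0.ne'
    push_cast
    field_simp at o2 ⊢
    linear_combination (t ^ 4 - 1) * F0 * o2 - 64 * t ^ 8 * G0 * o1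
  have hW := constant_of_has_deriv_right_zero
    (fun t ht => (hd t ht).continuousAt.continuousWithinAt)
    (fun t ht => (hd t ⟨ht.1, ht.2.le⟩).hasDerivWithinAt) 1 ⟨h1, le_rfl⟩
  rw [← hW]
  simp [landenWronskian]

/-- The Landen transformation in symmetric form. -/
theorem ellK_landen {s : ℝ} (h0 : 0 < s) (h1 : s ≤ 1) (h4 : 1 / 2 ≤ s ^ 4) :
    ellK (-(1 - s ^ 2) ^ 2 / (4 * s ^ 2)) = s * ellK (1 - s ^ 4) := by
  let f : ℝ → ℝ := fun t => ellK (-(1 - t ^ 2) ^ 2 / (4 * t ^ 2)) / (t * ellK (1 - t ^ 4))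
  have hpos : ∀ t ∈ Set.Icc s 1, 0 < ellK (1 - t ^ 4) := fun t ht => by
    have t0 : 0 < t := h0.trans_le ht.1
    exact ellK_pos (by linarith [pow_le_one₀ (n := 4) t0.le ht.2]) (by linarith [pow_pos t0 4])
  have hd : ∀ t ∈ Set.Icc s 1, HasDerivAt f (((1 - t ^ 4) / (2 * t ^ 3) *
      ellK' (-(1 - t ^ 2) ^ 2 / (4 * t ^ 2)) * (t * ellK (1 - t ^ 4))
      - ellK (-(1 - t ^ 2) ^ 2 / (4 * t ^ 2)) *
        (ellK (1 - t ^ 4) - t * (4 * t ^ 3) * ellK' (1 - t ^ 4)))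
      / (t * ellK (1 - t ^ 4)) ^ 2) t := by
    intro t ht
    have t0 : 0 < t := h0.trans_le ht.1
    have t4 : 1 / 2 ≤ t ^ 4 := h4.trans (pow_le_pow_left₀ h0.le ht.1 4)
    have db := (hasDerivAt_ellK (abs_one_sub_pow_four_lt t0 ht.2)).comp t
      (hasDerivAt_one_sub_pow_four t)
    have da := (hasDerivAt_ellK (abs_landenArg_lt t0 ht.2 t4)).comp t (hasDerivAt_landenArg t0)
    have d := da.div ((hasDerivAt_id t).mul db) (mul_pos t0 (hpos t ht)).ne'
    convert! d using 1
    simp only [Pi.mul_apply, Function.comp_apply, id]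
    ring
  have hd0 : ∀ t ∈ Set.Ico s 1, HasDerivWithinAt f 0 (Set.Ici t) t := by
    intro t ht
    have t0 : 0 < t := h0.trans_le ht.1
    have t4 : 1 / 2 ≤ t ^ 4 := h4.trans (pow_le_pow_left₀ h0.le ht.1 4)
    have hw := landenWronskian_eq_zero t0 ht.2.le t4
    have hlt : t ^ 4 < 1 := pow_lt_one₀ t0.le ht.2 (by norm_num)
    rw [landenWronskian, mul_eq_zero] at hw
    replace hw := hw.resolve_left (by linarith)
    have hf := (hpos t ⟨ht.1, ht.2.le⟩).ne'
    have ht' := t0.ne'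
    convert! (hd t ⟨ht.1, ht.2.le⟩).hasDerivWithinAt using 1
    symm
    rw [div_eq_zero_iff]
    left
    field_simp at hw ⊢
    linear_combination -hw
  have h := constant_of_has_deriv_right_zero
    (fun t ht => (hd t ht).continuousAt.continuousWithinAt) hd0 1 ⟨h1, le_rfl⟩
  have hf1 : f 1 = 1 := by simp [f, ellK_zero]
  rw [hf1] at h
  have hp := mul_pos h0 (hpos s ⟨le_rfl, h1⟩)
  exact ((div_eq_one_iff_eq hp.ne').1 h.symm)

theorem ellK'_landen {s : ℝ} (h0 : 0 < s) (h4 : s ^ 4 = 1 / 2) :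
    ellK' (-(1 - s ^ 2) ^ 2 / (4 * s ^ 2)) =
      4 * s ^ 3 * (ellK (1 / 2) - 2 * ellK' (1 / 2)) := by
  have h1 : s ≤ 1 := by
    by_contra! h
    have := one_lt_pow₀ h (n := 4) (by norm_num)
    linarith
  have hw := landenWronskian_eq_zero h0 h1 h4.ge
  have hl := ellK_landen h0 h1 h4.ge
  have hp : 0 < ellK (1 / 2) := ellK_pos (by norm_num) (by norm_num)
  rw [landenWronskian, hl, h4, show (1 : ℝ) - 1 / 2 = 1 / 2 by norm_num] at hw
  generalize ellK' (-(1 - s ^ 2) ^ 2 / (4 * s ^ 2)) = G1 at *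
  generalize ellK (1 / 2) = F0 at *
  generalize ellK' (1 / 2) = F1 at *
  have hs := h0.ne'
  have hF := hp.ne'
  field_simp at hw
  rw [mul_zero, mul_eq_zero] at hw
  linear_combination -(hw.resolve_left hF) - 16 * s ^ 3 * F1 * h4

/-- The coefficient of `α ^ a * β ^ b` in the homogeneous polynomial
`∑ i, C(n,i)² (α(1-β))^i (β(1-α))^(n-i)`. -/
def baileyCoeff (n a b : ℕ) : ℝ :=
  (-1) ^ (a + b + n) * n.choose a * n.choose b * (a + b).choose n

theorem succ_sub_mul_choose_succ (n a : ℕ) :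
    ((n : ℝ) + 1 - a) * (n + 1).choose a = (n + 1) * n.choose a := by
  rcases le_or_gt a (n + 1) with h | h
  · have h2 := Nat.choose_mul_succ_eq n a
    have h3 : (n.choose a : ℝ) * (n + 1) = (n + 1).choose a * ((n + 1 - a : ℕ) : ℝ) := by
      exact_mod_cast h2
    rw [Nat.cast_sub h] at h3
    push_cast at h3
    linear_combination -h3
  · rw [Nat.choose_eq_zero_of_lt h, Nat.choose_eq_zero_of_lt (by omega)]
    simp

theorem succ_mul_choose_succ (n a : ℕ) :
    ((a : ℝ) + 1) * n.choose (a + 1) = (n - a) * n.choose a := by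
  rcases le_or_gt a n with h | h
  · have h3 : (n.choose (a + 1) : ℝ) * (a + 1) = n.choose a * ((n - a : ℕ) : ℝ) := by
      exact_mod_cast Nat.choose_succ_right_eq n a
    rw [Nat.cast_sub h] at h3
    linear_combination h3
  · rw [Nat.choose_eq_zero_of_lt h, Nat.choose_eq_zero_of_lt (by omega)]
    simp

/-- The telescoping certificate for the sum `∑ n, ellCoeff n * baileyCoeff n a b`. -/
noncomputable def baileyCert (a b n : ℕ) : ℝ :=
  ellCoeff n * (-1) ^ (a + b + n) * n * ((n - a) * n.choose a) * ((n - b) * n.choose b)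
    * ((a + b + 1).choose n / (a + b + 1))

theorem baileyCert_sub (a b n : ℕ) :
    ((a : ℝ) + 1) ^ 2 * (ellCoeff n * baileyCoeff n (a + 1) b)
      - (a + 1 / 2) ^ 2 * (ellCoeff n * baileyCoeff n a b)
      = baileyCert a b (n + 1) - baileyCert a b n := by
  have hab : (a : ℝ) + b + 1 ≠ 0 := by positivity
  obtain ⟨Z, hZ⟩ : ∃ Z : ℝ, Z = (a + b + 1).choose n / (a + b + 1) := ⟨_, rfl⟩
  have e1 : ((a + 1 + b).choose n : ℝ) = (a + b + 1) * Z := by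
    rw [hZ, show a + 1 + b = a + b + 1 by ring]; field_simp
  have e2 : ((a + b).choose n : ℝ) = (a + b + 1 - n) * Z := by
    have := succ_sub_mul_choose_succ (a + b) n
    push_cast at this
    rw [hZ]; field_simp; linear_combination -this
  have e3 : ((n : ℝ) + 1) * ((a + b + 1).choose (n + 1) / (a + b + 1)) = (a + b + 1 - n) * Z := by
    have := succ_mul_choose_succ (a + b + 1) n
    push_cast at this
    rw [hZ]; field_simp; linear_combination this
  have x1 := succ_mul_choose_succ n a
  have x2 := succ_sub_mul_choose_succ n a
  have y2 := succ_sub_mul_choose_succ n b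
  have hA := ellCoeff_succ n
  have hL : ((a : ℝ) + 1) ^ 2 * (ellCoeff n * baileyCoeff n (a + 1) b)
      = (a + 1) * ellCoeff n * (-1) ^ (a + 1 + b + n) * (((a : ℝ) + 1) * n.choose (a + 1))
        * n.choose b * (a + 1 + b).choose n := by
    unfold baileyCoeff; ring
  have hR : baileyCert a b (n + 1) = (-1) ^ (a + b + (n + 1)) * ellCoeff (n + 1)
      * (((n : ℝ) + 1 - a) * (n + 1).choose a) * (((n : ℝ) + 1 - b) * (n + 1).choose b)
      * (((n : ℝ) + 1) * ((a + b + 1).choose (n + 1) / (a + b + 1))) := by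
    unfold baileyCert; push_cast; ring
  have hR' : baileyCert a b (n + 1) = (-1) ^ (a + b + (n + 1)) *
      (((n : ℝ) + 1) ^ 2 * ellCoeff (n + 1)) * n.choose a * n.choose b * ((a + b + 1 - n) * Z) := by
    rw [hR, x2, y2, e3]; ring
  rw [hL, hR', hA, x1, e1]
  unfold baileyCoeff baileyCert
  rw [e2, ← hZ]
  ring

theorem sum_ellCoeff_mul_baileyCoeff (a b : ℕ) :
    ∑ n ∈ Finset.range (a + b + 1), ellCoeff n * baileyCoeff n a b = ellCoeff a * ellCoeff b := by
  induction a with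
  | zero =>
    rw [zero_add, Finset.sum_range_succ, Finset.sum_eq_zero]
    · simp [baileyCoeff, ellCoeff_zero, ← two_mul]
    · intro n hn
      rw [baileyCoeff, Nat.choose_eq_zero_of_lt (Finset.mem_range.1 hn)]
      simp
  | succ a ih =>
    have h := Finset.sum_range_sub (baileyCert a b) (a + b + 2)
    rw [← Finset.sum_congr rfl fun n _ => baileyCert_sub a b n, Finset.sum_sub_distrib,
      ← Finset.mul_sum, ← Finset.mul_sum,
      Finset.sum_range_succ (fun n => ellCoeff n * baileyCoeff n a b) (a + b + 1), ih] at h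
    have h0 : baileyCert a b 0 = 0 := by simp [baileyCert]
    have h1 : baileyCert a b (a + b + 2) = 0 := by
      simp [baileyCert]
    have h2 : baileyCoeff (a + b + 1) a b = 0 := by
      simp [baileyCoeff]
    have e : a + 1 + b + 1 = a + b + 2 := by ring
    rw [h0, h1, h2] at h
    rw [e]
    have h3 := ellCoeff_succ a
    have h4 : ((a : ℝ) + 1) ^ 2 ≠ 0 := by positivity
    apply mul_left_cancel₀ h4
    linear_combination h - ellCoeff b * h3

theorem choose_mul_pow_mul_one_sub_pow (n i : ℕ) (hi : i ≤ n) (x : ℝ) :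
    (n.choose i : ℝ) * (x ^ i * (1 - x) ^ (n - i)) =
      ∑ a ∈ Finset.range (n + 1), (-1) ^ (a + i) * n.choose a * a.choose i * x ^ a := by
  have hsplit : n + 1 = i + (n - i + 1) := by omega
  rw [hsplit, Finset.sum_range_add, Finset.sum_eq_zero, zero_add, sub_eq_neg_add, add_pow,
    Finset.mul_sum, Finset.mul_sum]
  · refine Finset.sum_congr rfl fun k hk => ?_
    have hk' : k ≤ n - i := Nat.lt_succ_iff.1 (Finset.mem_range.1 hk)
    have h := Nat.choose_mul (n := n) (k := i + k) (s := i) (by omega)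
    rw [Nat.add_sub_cancel_left] at h
    have h' : (n.choose (i + k) : ℝ) * (i + k).choose i = n.choose i * (n - i).choose k := by
      exact_mod_cast h
    rw [neg_pow, one_pow, mul_one, show i + k + i = 2 * i + k by ring, pow_add _ (2 * i), pow_mul]
    norm_num
    linear_combination (-(-1) ^ k * x ^ (i + k)) * h'
  · intro a ha
    rw [Nat.choose_eq_zero_of_lt (Finset.mem_range.1 ha)]
    simp

theorem sum_choose_sq_bailey (n : ℕ) (x y : ℝ) :
    ∑ i ∈ Finset.range (n + 1), (n.choose i : ℝ) ^ 2 * (x * (1 - y)) ^ i * (y * (1 - x)) ^ (n - i)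
      = ∑ a ∈ Finset.range (n + 1), ∑ b ∈ Finset.range (n + 1),
          baileyCoeff n a b * x ^ a * y ^ b := by
  have h1 : ∀ i ∈ Finset.range (n + 1),
      (n.choose i : ℝ) ^ 2 * (x * (1 - y)) ^ i * (y * (1 - x)) ^ (n - i) =
      ∑ a ∈ Finset.range (n + 1), ∑ b ∈ Finset.range (n + 1),
        (-1) ^ (a + b + n) * n.choose a * n.choose b * x ^ a * y ^ b
          * (a.choose i * b.choose (n - i)) := by
    intro i hi
    have hi' : i ≤ n := Nat.lt_succ_iff.1 (Finset.mem_range.1 hi)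
    have e1 := choose_mul_pow_mul_one_sub_pow n i hi' x
    have e2 := choose_mul_pow_mul_one_sub_pow n (n - i) (Nat.sub_le _ _) y
    rw [Nat.choose_symm hi', Nat.sub_sub_self hi'] at e2
    calc _ = ((n.choose i : ℝ) * (x ^ i * (1 - x) ^ (n - i)))
          * ((n.choose i : ℝ) * (y ^ (n - i) * (1 - y) ^ i)) := by rw [mul_pow, mul_pow]; ring
      _ = _ := by
        rw [e1, e2, Finset.sum_mul_sum]
        refine Finset.sum_congr rfl fun a _ => Finset.sum_congr rfl fun b _ => ?_
        have : ((-1 : ℝ)) ^ (a + b + n) = (-1) ^ (a + i) * (-1) ^ (b + (n - i)) := by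
          rw [← pow_add]; congr 1; omega
        rw [this]; ring
  rw [Finset.sum_congr rfl h1, Finset.sum_comm]
  refine Finset.sum_congr rfl fun a _ => ?_
  rw [Finset.sum_comm]
  refine Finset.sum_congr rfl fun b _ => ?_
  rw [← Finset.mul_sum]
  have h := Nat.add_choose_eq a b n
  rw [Finset.Nat.sum_antidiagonal_eq_sum_range_succ_mk] at h
  rw [baileyCoeff, h]
  push_cast
  ring

theorem sum_choose_sq_le {U V p q : ℝ} (hU : 0 ≤ U) (hV : 0 ≤ V) (hp : 0 ≤ p) (hq : 0 ≤ q)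
    (hUp : U ≤ p ^ 2) (hVq : V ≤ q ^ 2) (n : ℕ) :
    ∑ i ∈ Finset.range (n + 1), (n.choose i : ℝ) ^ 2 * U ^ i * V ^ (n - i)
      ≤ ((p + q) ^ 2) ^ n := by
  calc _ ≤ ∑ i ∈ Finset.range (n + 1), (p ^ i * q ^ (n - i) * n.choose i) ^ 2 := by
        refine Finset.sum_le_sum fun i _ => ?_
        calc _ ≤ (n.choose i : ℝ) ^ 2 * (p ^ 2) ^ i * (q ^ 2) ^ (n - i) := by gcongr
          _ = _ := by ring
    _ ≤ (∑ i ∈ Finset.range (n + 1), p ^ i * q ^ (n - i) * n.choose i) ^ 2 :=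
        Finset.sum_sq_le_sq_sum_of_nonneg fun i _ => by positivity
    _ = _ := by rw [← add_pow, ← pow_mul, ← pow_mul, mul_comm]

theorem baileyCoeff_eq_zero {n a b : ℕ} (h : a ∉ Finset.range (n + 1) ∨ b ∉ Finset.range (n + 1)) :
    baileyCoeff n a b = 0 := by
  simp only [Finset.mem_range, not_lt] at h
  rcases h with h | h
  · rw [baileyCoeff, Nat.choose_eq_zero_of_lt (show n < a from h)]; simp
  · rw [baileyCoeff, Nat.choose_eq_zero_of_lt (show n < b from h)]; simp

theorem hasSum_baileyCoeff (n : ℕ) (x y : ℝ) :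
    HasSum (fun p : ℕ × ℕ => baileyCoeff n p.1 p.2 * x ^ p.1 * y ^ p.2)
      (∑ i ∈ Finset.range (n + 1),
        (n.choose i : ℝ) ^ 2 * (x * (1 - y)) ^ i * (y * (1 - x)) ^ (n - i)) := by
  rw [sum_choose_sq_bailey, ← Finset.sum_product']
  refine hasSum_sum_of_ne_finset_zero fun p hp => ?_
  rw [Finset.mem_product, not_and_or] at hp
  rw [baileyCoeff_eq_zero hp]
  simp

theorem abs_baileyCoeff (n a b : ℕ) :
    |baileyCoeff n a b| = (-1) ^ (a + b + n) * baileyCoeff n a b := by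
  have h : ((-1 : ℝ)) ^ (a + b + n) * (-1) ^ (a + b + n) = 1 := by
    rw [← mul_pow]; norm_num
  have h2 : (-1) ^ (a + b + n) * baileyCoeff n a b
      = (n.choose a : ℝ) * n.choose b * (a + b).choose n := by
    rw [baileyCoeff]; linear_combination (n.choose a : ℝ) * n.choose b * (a + b).choose n * h
  rw [h2, baileyCoeff, abs_mul, abs_mul, abs_mul, abs_pow, abs_neg, abs_one, one_pow, one_mul]
  simp

/-- The generating function of Bailey and Brafman. -/
theorem hasSum_bailey {x y p q : ℝ} (hx : |x| < 1) (hy : |y| < 1) (hp : 0 ≤ p) (hq : 0 ≤ q)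
    (hxp : |x| * (1 + |y|) ≤ p ^ 2) (hyq : |y| * (1 + |x|) ≤ q ^ 2) (hpq : p + q < 1) :
    HasSum (fun n => ellCoeff n * ∑ i ∈ Finset.range (n + 1),
        (n.choose i : ℝ) ^ 2 * (x * (1 - y)) ^ i * (y * (1 - x)) ^ (n - i))
      (ellK x * ellK y) := by
  let F : ℕ × (ℕ × ℕ) → ℝ := fun t =>
    ellCoeff t.1 * (baileyCoeff t.1 t.2.1 t.2.2 * x ^ t.2.1 * y ^ t.2.2)
  have habs : ∀ n, HasSum (fun t : ℕ × ℕ => |F (n, t)|) (ellCoeff n * ∑ i ∈ Finset.range (n + 1),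
        (n.choose i : ℝ) ^ 2 * (|x| * (1 + |y|)) ^ i * (|y| * (1 + |x|)) ^ (n - i)) := by
    intro n
    have h := ((hasSum_baileyCoeff n (-|x|) (-|y|)).mul_left ((-1) ^ n)).mul_left (ellCoeff n)
    convert! h using 1
    · funext t
      simp only [F]
      rw [abs_mul, abs_mul, abs_mul, abs_of_pos (ellCoeff_pos n), abs_baileyCoeff, abs_pow,
        abs_pow, neg_pow |x|, neg_pow |y|]
      ring
    · congr 1
      rw [Finset.mul_sum]
      refine Finset.sum_congr rfl fun i hi => ?_
      have hi' : i ≤ n := Nat.lt_succ_iff.1 (Finset.mem_range.1 hi)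
      rw [sub_neg_eq_add, sub_neg_eq_add, neg_mul, neg_mul, neg_pow (|x| * _),
        neg_pow (|y| * _)]
      have : ((-1 : ℝ)) ^ n * ((-1) ^ i * (-1) ^ (n - i)) = 1 := by
        rw [← pow_add, Nat.add_sub_cancel' hi', ← mul_pow]; norm_num
      linear_combination (-((n.choose i : ℝ) ^ 2 * (|x| * (1 + |y|)) ^ i
        * (|y| * (1 + |x|)) ^ (n - i))) * this
  have hF : Summable F := by
    refine Summable.of_norm ?_
    rw [summable_prod_of_nonneg fun _ => norm_nonneg _]
    refine ⟨fun n => (habs n).summable, ?_⟩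
    have hr : (p + q) ^ 2 < 1 := pow_lt_one₀ (by positivity) hpq (by norm_num)
    refine Summable.of_nonneg_of_le (fun n => tsum_nonneg fun _ => norm_nonneg _) (fun n => ?_)
      (summable_geometric_of_lt_one (sq_nonneg _) hr)
    have := (habs n).tsum_eq
    simp only [Real.norm_eq_abs]
    rw [this]
    have h1 := sum_choose_sq_le (by positivity) (by positivity) hp hq hxp hyq n
    calc _ ≤ 1 * ((p + q) ^ 2) ^ n :=
          mul_le_mul (ellCoeff_le_one n) h1 (Finset.sum_nonneg fun _ _ => by positivity) zero_le_one
      _ = _ := one_mul _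
  have hrow := hF.hasSum.prod_fiberwise fun n => (hasSum_baileyCoeff n x y).mul_left (ellCoeff n)
  convert! hrow using 1
  have hswap := (Equiv.prodComm (ℕ × ℕ) ℕ).hasSum_iff.2 hF.hasSum
  have hcol := hswap.prod_fiberwise
    (g := fun t => (ellCoeff t.1 * x ^ t.1) * (ellCoeff t.2 * y ^ t.2))
    (fun t => by
      have e : (ellCoeff t.1 * x ^ t.1) * (ellCoeff t.2 * y ^ t.2)
          = ∑ n ∈ Finset.range (t.1 + t.2 + 1), F (n, t) := by
        calc _ = ellCoeff t.1 * ellCoeff t.2 * (x ^ t.1 * y ^ t.2) := by ring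
          _ = _ := by
            rw [← sum_ellCoeff_mul_baileyCoeff, Finset.sum_mul]
            exact Finset.sum_congr rfl fun n _ => by simp only [F]; ring
      rw [e]
      refine hasSum_sum_of_ne_finset_zero fun n hn => ?_
      have : t.1 + t.2 < n := by simpa using hn
      simp [F, baileyCoeff, Nat.choose_eq_zero_of_lt this])
  have hprod := summable_mul_of_summable_norm (absConv_ellCoeff.summable hx).norm
    (absConv_ellCoeff.summable hy).norm
  rw [ellK, powerSum, powerSum, (absConv_ellCoeff.summable hx).tsum_mul_tsum
    (absConv_ellCoeff.summable hy) hprod]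
  exact hprod.hasSum.unique hcol

theorem legendreP_mul_pow (n : ℕ) (x z : ℝ) :
    legendreP n x * z ^ n = ∑ i ∈ Finset.range (n + 1),
      (n.choose i : ℝ) ^ 2 * (z * (x - 1) / 2) ^ i * (z * (x + 1) / 2) ^ (n - i) := by
  rw [legendreP, ← Finset.sum_range_reflect, Finset.mul_sum, Finset.sum_mul]
  refine Finset.sum_congr rfl fun i hi => ?_
  have hi' : i ≤ n := Nat.lt_succ_iff.1 (Finset.mem_range.1 hi)
  have e : n + 1 - 1 - i = n - i := by omega
  rw [e, Nat.choose_symm hi', Nat.sub_sub_self hi']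
  have h : ∀ w : ℝ, w ^ n = w ^ i * w ^ (n - i) := fun w => by
    rw [← pow_add, Nat.add_sub_cancel' hi']
  rw [h (2 : ℝ)⁻¹, h z, mul_div_assoc, mul_div_assoc, mul_pow, mul_pow, div_eq_mul_inv,
    div_eq_mul_inv, mul_pow, mul_pow]
  ring

theorem abs_legendreP_le {x p q : ℝ} (hx : |x| ≤ 1) (hp : 0 ≤ p) (hq : 0 ≤ q)
    (hxp : (1 - x) / 2 ≤ p ^ 2) (hxq : (1 + x) / 2 ≤ q ^ 2) (n : ℕ) :
    |legendreP n x| ≤ ((p + q) ^ 2) ^ n := by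
  obtain ⟨h1, h2⟩ := abs_le.1 hx
  have h := legendreP_mul_pow n x 1
  rw [one_pow, mul_one] at h
  rw [h]
  refine (Finset.abs_sum_le_sum_abs _ _).trans (le_trans (le_of_eq ?_)
    (sum_choose_sq_le (U := (1 - x) / 2) (V := (1 + x) / 2) (by linarith) (by linarith)
      hp hq hxp hxq n))
  refine Finset.sum_congr rfl fun i _ => ?_
  rw [abs_mul, abs_mul, abs_pow, abs_pow, abs_pow, Nat.abs_cast,
    abs_of_nonpos (show 1 * (x - 1) / 2 ≤ 0 by linarith),
    abs_of_nonneg (show 0 ≤ 1 * (x + 1) / 2 by linarith)]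
  congr 3 <;> ring

theorem absConv_ellCoeff_mul_legendreP {x p q R : ℝ} (hx : |x| ≤ 1) (hp : 0 ≤ p) (hq : 0 ≤ q)
    (hxp : (1 - x) / 2 ≤ p ^ 2) (hxq : (1 + x) / 2 ≤ q ^ 2) (hR : (p + q) ^ 2 * R < 1) :
    AbsConv R fun n => ellCoeff n * legendreP n x := by
  intro r h0 hr
  have h1 : (p + q) ^ 2 * r < 1 :=
    (mul_le_mul_of_nonneg_left hr.le (sq_nonneg _)).trans_lt hR
  refine Summable.of_nonneg_of_le (fun n => by positivity) (fun n => ?_)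
    (summable_geometric_of_lt_one (by positivity) h1)
  rw [mul_pow, abs_mul, abs_of_pos (ellCoeff_pos n)]
  refine mul_le_mul_of_nonneg_right ?_ (by positivity)
  exact (mul_le_of_le_one_left (abs_nonneg _) (ellCoeff_le_one n)).trans
    (abs_legendreP_le hx hp hq hxp hxq n)

/-- Brafman's formula. -/
theorem powerSum_ellCoeff_mul_legendreP {x z ρ p q : ℝ} (hρ : ρ ^ 2 = 1 - 2 * x * z + z ^ 2)
    (ha : |(1 - ρ - z) / 2| < 1) (hb : |(1 - ρ + z) / 2| < 1) (hp : 0 ≤ p) (hq : 0 ≤ q)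
    (hxp : |(1 - ρ - z) / 2| * (1 + |(1 - ρ + z) / 2|) ≤ p ^ 2)
    (hyq : |(1 - ρ + z) / 2| * (1 + |(1 - ρ - z) / 2|) ≤ q ^ 2) (hpq : p + q < 1) :
    powerSum (fun n => ellCoeff n * legendreP n x) z =
      ellK ((1 - ρ - z) / 2) * ellK ((1 - ρ + z) / 2) := by
  rw [← (hasSum_bailey ha hb hp hq hxp hyq hpq).tsum_eq]
  refine tsum_congr fun n => ?_
  rw [mul_assoc, legendreP_mul_pow]
  have e1 : (1 - ρ - z) / 2 * (1 - (1 - ρ + z) / 2) = z * (x - 1) / 2 := by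
    linear_combination -hρ / 4
  have e2 : (1 - ρ + z) / 2 * (1 - (1 - ρ - z) / 2) = z * (x + 1) / 2 := by
    linear_combination -hρ / 4
  rw [e1, e2]

theorem hasDerivAt_powerSum_ellCoeff_mul_legendreP :
    HasDerivAt (powerSum fun n => ellCoeff n * legendreP n (2 * √2 / 3))
      (-(1 / 9) * ellK' ((4 - 3 * √2) / 8) * ellK (1 / 2)
        + 8 / 9 * ellK ((4 - 3 * √2) / 8) * ellK' (1 / 2)) (3 * √2 / 8) ∧
    powerSum (fun n => ellCoeff n * legendreP n (2 * √2 / 3)) (3 * √2 / 8) =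
      ellK ((4 - 3 * √2) / 8) * ellK (1 / 2) := by
  have h2 : √2 ^ 2 = 2 := Real.sq_sqrt (by norm_num)
  have hl : 1.414 < √2 := Real.lt_sqrt_of_sq_lt (by norm_num)
  have hu : √2 < 1.4143 := (Real.sqrt_lt' (by norm_num)).2 (by norm_num)
  let R : ℝ → ℝ := fun z => 1 - 2 * (2 * √2 / 3) * z + z ^ 2
  let A : ℝ → ℝ := fun z => (1 - √(R z) - z) / 2
  let B : ℝ → ℝ := fun z => (1 - √(R z) + z) / 2
  have hR0 : R (3 * √2 / 8) = (3 * √2 / 8) ^ 2 := by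
    simp only [R]; linear_combination (-1 / 2) * h2
  have hρ0 : √(R (3 * √2 / 8)) = 3 * √2 / 8 := by
    rw [hR0, Real.sqrt_sq (by positivity)]
  have hA0 : A (3 * √2 / 8) = (4 - 3 * √2) / 8 := by simp only [A, hρ0]; ring
  have hB0 : B (3 * √2 / 8) = 1 / 2 := by simp only [B, hρ0]; ring
  have hA0' : |A (3 * √2 / 8)| = (3 * √2 - 4) / 8 := by
    rw [hA0, abs_of_nonpos (by linarith)]; ring
  have hB0' : |B (3 * √2 / 8)| = 1 / 2 := by rw [hB0]; norm_num
  have cR : Continuous R := by fun_prop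
  have cA : Continuous A := by fun_prop
  have cB : Continuous B := by fun_prop
  have hev : ∀ᶠ z in nhds (3 * √2 / 8),
      powerSum (fun n => ellCoeff n * legendreP n (2 * √2 / 3)) z = ellK (A z) * ellK (B z) := by
    have v1 := continuousAt_const.eventually_lt cR.continuousAt
      (show 0 < R (3 * √2 / 8) by rw [hR0]; positivity)
    have v2 := cA.abs.continuousAt.eventually_lt continuousAt_const
      (show |A (3 * √2 / 8)| < 1 by rw [hA0']; linarith)
    have v3 := cB.abs.continuousAt.eventually_lt continuousAt_const
      (show |B (3 * √2 / 8)| < 1 by rw [hB0']; norm_num)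
    have v4 := (cA.abs.mul (continuous_const.add cB.abs)).continuousAt.eventually_lt
      continuousAt_const
      (show |A (3 * √2 / 8)| * (1 + |B (3 * √2 / 8)|) < 0.22 ^ 2 by
        rw [hA0', hB0']; norm_num; linarith)
    have v5 := (cB.abs.mul (continuous_const.add cA.abs)).continuousAt.eventually_lt
      continuousAt_const
      (show |B (3 * √2 / 8)| * (1 + |A (3 * √2 / 8)|) < 0.73 ^ 2 by
        rw [hA0', hB0']; norm_num; linarith)
    filter_upwards [v1, v2, v3, v4, v5] with z w1 w2 w3 w4 w5
    exact powerSum_ellCoeff_mul_legendreP (Real.sq_sqrt w1.le) w2 w3 (by norm_num) (by norm_num)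
      w4.le w5.le (by norm_num)
  have hval := hev.self_of_nhds
  rw [hA0, hB0] at hval
  refine ⟨HasDerivAt.congr_of_eventuallyEq ?_ hev, hval⟩
  have dR : HasDerivAt R (-(7 / 12 * √2)) (3 * √2 / 8) := by
    have d := ((hasDerivAt_id (3 * √2 / 8)).const_mul (2 * (2 * √2 / 3))).const_sub 1 |>.add
      (hasDerivAt_pow 2 (3 * √2 / 8))
    convert! d using 1
    push_cast; ring
  have dρ : HasDerivAt (fun z => √(R z)) (-(7 / 9)) (3 * √2 / 8) := by
    have d := dR.sqrt (by rw [hR0]; positivity)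
    rw [hρ0] at d
    convert! d using 1
    field_simp; norm_num
  have dA : HasDerivAt A (-(1 / 9)) (3 * √2 / 8) := by
    have d := ((dρ.const_sub 1).sub (hasDerivAt_id _)).div_const 2
    convert! d using 1
    norm_num
  have dB : HasDerivAt B (8 / 9) (3 * √2 / 8) := by
    have d := ((dρ.const_sub 1).add (hasDerivAt_id _)).div_const 2
    convert! d using 1
    norm_num
  have dKA := (hasDerivAt_ellK (m := A (3 * √2 / 8)) (by rw [hA0']; linarith)).comp _ dA
  have dKB := (hasDerivAt_ellK (m := B (3 * √2 / 8)) (by rw [hB0']; norm_num)).comp _ dB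
  have d := dKA.mul dKB
  rw [hA0, hB0] at d
  convert! d using 1
  simp only [Function.comp_apply, hA0, hB0]
  ring

theorem stmt9 :
    Tendsto (fun N => ∑ n ∈ Finset.range N,
      ((2 * n).choose n : ℝ) ^ 2 * legendreP n (2 * Real.sqrt 2 / 3) *
        (3 * Real.sqrt 2 / 128) ^ n * (6 * (n : ℝ) + 1))
      atTop (nhds (2 * Real.sqrt (8 + 6 * Real.sqrt 2) / π)) := by
  have h2 : √2 ^ 2 = 2 := Real.sq_sqrt (by norm_num)
  have hl : 1.414 < √2 := Real.lt_sqrt_of_sq_lt (by norm_num)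
  have hu : √2 < 1.4143 := (Real.sqrt_lt' (by norm_num)).2 (by norm_num)
  have hconv : AbsConv 0.7 fun n => ellCoeff n * legendreP n (2 * √2 / 3) :=
    absConv_ellCoeff_mul_legendreP (p := 0.18) (q := 0.99)
      (by rw [abs_of_pos (by positivity)]; linarith) (by norm_num) (by norm_num)
      (by norm_num; linarith) (by norm_num; linarith) (by norm_num)
  have hz : |3 * √2 / 8| < 0.7 := by rw [abs_of_pos (by positivity)]; linarith
  obtain ⟨hder, hval⟩ := hasDerivAt_powerSum_ellCoeff_mul_legendreP
  have hder' := hder.unique (hconv.hasDerivAt hz)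
  have hsum := ((hconv.hasSum_natCast_mul hz).mul_left 6).add (hconv.summable hz).hasSum
  change HasSum _ (_ + powerSum (fun n => ellCoeff n * legendreP n (2 * √2 / 3)) _) at hsum
  rw [← hder', hval] at hsum
  obtain ⟨s, hs0, hs⟩ : ∃ s : ℝ, 0 < s ∧ √2 = 2 * s ^ 2 :=
    ⟨√(√2 / 2), by positivity, by rw [Real.sq_sqrt (by positivity)]; ring⟩
  have hs4 : s ^ 4 = 1 / 2 := by rw [hs] at h2; linear_combination h2 / 4
  have harg : (4 - 3 * √2) / 8 = -(1 - s ^ 2) ^ 2 / (4 * s ^ 2) := by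
    rw [hs]; field_simp; linear_combination (-16) * hs4
  have hs1 : s ≤ 1 := by
    by_contra! h
    have := one_lt_pow₀ h (n := 4) (by norm_num)
    linarith
  have hK := ellK_landen hs0 hs1 hs4.ge
  have hK' := ellK'_landen hs0 hs4
  rw [hs4, show (1 : ℝ) - 1 / 2 = 1 / 2 by norm_num] at hK
  rw [harg, hK, hK'] at hsum
  have hroot : √(8 + 6 * √2) = s * (2 + 4 * s ^ 2) := by
    rw [Real.sqrt_eq_iff_mul_self_eq (by positivity) (by positivity), hs]
    linear_combination (-16 * s ^ 2 - 16) * hs4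
  convert! hsum.tendsto_sum_nat using 1
  · funext N
    refine Finset.sum_congr rfl fun n _ => ?_
    have e : (3 * √2 / 128) ^ n = (3 * √2 / 8) ^ n / (4 ^ n) ^ 2 := by
      rw [← pow_mul, mul_comm n 2, pow_mul, ← div_pow]; congr 1; ring
    rw [e, ellCoeff, Nat.centralBinom]
    field_simp
  · congr 1
    rw [hroot, hs]
    have hleg := ellK_half_mul_ellK'_half
    generalize ellK (1 / 2) = K at *
    generalize ellK' (1 / 2) = K' at *
    have e : 2 * (s * (2 + 4 * s ^ 2)) / π = s * (2 + 4 * s ^ 2) * (K * K') := by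
      rw [hleg]; ring
    rw [e]
    linear_combination (2 * s * K ^ 2 - 4 * s * K * K') * hs4
end

section
/- For every real number k with 0 < k < 1 and k ≠ 1/3, the series ∑_{n=0}^∞ ((1/4)_n (3/4)_n / (n!)²) · P_n((1 + k)(1 − 4k + 7k²)/((1 − 3k)(1 + 3k²))) · ((1 + k)(1 − 3k)(1 + 3k²)/(1 + 3k)²)^n · (C₃n³ + C₂n² + C₁n + C₀) converges to 3√2·(1 + 3k)^{5/2}(1 + 3k²)/((1 + k)π), where C₃ = (16(k−1)²k²/(1+k)²)(8 + 15k + 9k²)², C₂ = 48(k−1)k(8 − 15k + 27k² + 27k³ + 81k⁴), C₁ = (4 − 33k + 45k²)(4 − 17k + 17k² − 3k³ + 63k⁴), and C₀ = 3(1 − 3k)⁴(1 + k + 2k²). -/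
open Real Filter

/-- The Pochhammer symbol (rising factorial) `(a)_n = a (a+1) ⋯ (a+n-1)`. -/
noncomputable def poch (a : ℝ) (n : ℕ) : ℝ := (ascPochhammer ℝ n).eval a

/-- The coefficient `(1/4)_n (3/4)_n / (n!)^2`. -/
noncomputable def quarterCoeff (n : ℕ) : ℝ :=
  poch (1 / 4) n * poch (3 / 4) n / (n.factorial : ℝ) ^ 2

theorem poch_zero (a : ℝ) : poch a 0 = 1 := by simp [poch]

theorem poch_succ (a : ℝ) (n : ℕ) : poch a (n + 1) = poch a n * (a + n) := by
  simp [poch, ascPochhammer_succ_eval]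

theorem poch_nonneg {a : ℝ} (ha : 0 ≤ a) (n : ℕ) : 0 ≤ poch a n := by
  induction n with
  | zero => simp [poch_zero]
  | succ n ih => rw [poch_succ]; positivity

theorem poch_le_factorial {a : ℝ} (ha : 0 ≤ a) (ha' : a ≤ 1) (n : ℕ) :
    poch a n ≤ n.factorial := by
  induction n with
  | zero => simp [poch_zero]
  | succ n ih =>
    rw [poch_succ, Nat.factorial_succ, mul_comm (n + 1)]
    push_cast
    exact mul_le_mul ih (by linarith) (by positivity) (by positivity)

theorem quarterCoeff_zero : quarterCoeff 0 = 1 := by simp [quarterCoeff, poch_zero]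

theorem quarterCoeff_nonneg (n : ℕ) : 0 ≤ quarterCoeff n := by
  have h₁ := poch_nonneg (a := 1 / 4) (by norm_num) n
  have h₂ := poch_nonneg (a := 3 / 4) (by norm_num) n
  unfold quarterCoeff
  positivity

theorem quarterCoeff_le_one (n : ℕ) : quarterCoeff n ≤ 1 := by
  have h₁ := poch_le_factorial (a := 1 / 4) (by norm_num) (by norm_num) n
  have h₂ := poch_le_factorial (a := 3 / 4) (by norm_num) (by norm_num) n
  have h₃ := poch_nonneg (a := 3 / 4) (by norm_num) n
  unfold quarterCoeff
  rw [div_le_one (by positivity), sq]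
  gcongr

theorem quarterCoeff_succ (n : ℕ) :
    quarterCoeff (n + 1) * (n + 1) ^ 2 = (n + 1 / 4) * (n + 3 / 4) * quarterCoeff n := by
  have : (n.factorial : ℝ) ≠ 0 := by positivity
  unfold quarterCoeff
  rw [poch_succ, poch_succ, Nat.factorial_succ]
  push_cast
  field_simp
  ring

/-- The coefficients of the double series
`∑ (1/4)_{m+n} (3/4)_{m+n} / (m!^2 n!^2) X^m Y^n`. -/
noncomputable def appellCoeff (p : ℕ × ℕ) : ℝ :=
  quarterCoeff (p.1 + p.2) * ((p.1 + p.2).choose p.1 : ℝ) ^ 2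

theorem appellCoeff_nonneg (p : ℕ × ℕ) : 0 ≤ appellCoeff p :=
  mul_nonneg (quarterCoeff_nonneg _) (sq_nonneg _)

theorem appellCoeff_swap (p : ℕ × ℕ) : appellCoeff p.swap = appellCoeff p := by
  simp only [appellCoeff, Prod.fst_swap, Prod.snd_swap]
  rw [add_comm, Nat.choose_symm_add]

theorem appellCoeff_succ_left (m n : ℕ) :
    appellCoeff (m + 1, n) * ((m + 1 : ℕ) : ℝ) ^ 2 =
      (((m : ℝ) + n) + 1 / 4) * (((m : ℝ) + n) + 3 / 4) * appellCoeff (m, n) := by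
  have h₁ := quarterCoeff_succ (m + n)
  have h₂ : ((m : ℝ) + n + 1) * ((m + n).choose m : ℝ) =
      ((m + 1 + n).choose (m + 1) : ℝ) * (m + 1) := by
    have := Nat.add_one_mul_choose_eq (m + n) m
    rw [show m + n + 1 = m + 1 + n by omega] at this
    have h := congrArg (Nat.cast (R := ℝ)) this
    push_cast at h
    linear_combination h
  unfold appellCoeff
  simp only
  rw [show m + 1 + n = m + n + 1 by omega] at *
  push_cast at *
  calc _ = quarterCoeff (m + n + 1) * (((m + n + 1).choose (m + 1) : ℝ) * (m + 1)) ^ 2 := by ring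
    _ = (quarterCoeff (m + n + 1) * ((m : ℝ) + n + 1) ^ 2) * ((m + n).choose m : ℝ) ^ 2 := by
      rw [← h₂]; ring
    _ = _ := by rw [h₁]; ring

theorem appellCoeff_mul_le {s t : ℝ} (hs : 0 ≤ s) (ht : 0 ≤ t) (p : ℕ × ℕ) :
    appellCoeff p * ((s ^ 2) ^ p.1 * (t ^ 2) ^ p.2) ≤ ((s + t) ^ 2) ^ (p.1 + p.2) := by
  obtain ⟨m, n⟩ := p
  have h : s ^ m * t ^ n * ((m + n).choose m : ℝ) ≤ (s + t) ^ (m + n) := by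
    rw [add_pow]
    have := Finset.single_le_sum (s := Finset.range (m + n + 1))
      (f := fun i => s ^ i * t ^ (m + n - i) * ((m + n).choose i : ℝ))
      (fun i _ => by positivity) (Finset.mem_range.2 (show m < m + n + 1 by omega))
    simpa using this
  calc _ = quarterCoeff (m + n) * (s ^ m * t ^ n * ((m + n).choose m : ℝ)) ^ 2 := by
        simp only [appellCoeff]; ring
    _ ≤ 1 * ((s + t) ^ (m + n)) ^ 2 := by
        gcongr
        · exact quarterCoeff_le_one _
    _ = _ := by rw [one_mul, ← pow_mul, ← pow_mul, mul_comm]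

/-- A weight on `ℕ × ℕ` of at most polynomial growth. -/
def PolyBounded (w : ℕ × ℕ → ℝ) : Prop :=
  ∃ (C : ℝ) (d : ℕ), ∀ p, |w p| ≤ C * ((p.1 : ℝ) + p.2 + 1) ^ d

namespace PolyBounded

variable {v w : ℕ × ℕ → ℝ}

theorem const (c : ℝ) : PolyBounded fun _ => c := ⟨|c|, 0, fun p => by simp⟩

theorem fst : PolyBounded fun p => (p.1 : ℝ) :=
  ⟨1, 1, fun p => by
    rw [abs_of_nonneg (by positivity)]
    have : (0 : ℝ) ≤ p.2 := by positivity
    linarith⟩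

theorem snd : PolyBounded fun p => (p.2 : ℝ) :=
  ⟨1, 1, fun p => by
    rw [abs_of_nonneg (by positivity)]
    have : (0 : ℝ) ≤ p.1 := by positivity
    linarith⟩

theorem mul (hv : PolyBounded v) (hw : PolyBounded w) : PolyBounded fun p => v p * w p := by
  obtain ⟨C, d, h⟩ := hv
  obtain ⟨C', d', h'⟩ := hw
  refine ⟨C * C', d + d', fun p => ?_⟩
  rw [abs_mul]
  calc _ ≤ (C * ((p.1 : ℝ) + p.2 + 1) ^ d) * (C' * ((p.1 : ℝ) + p.2 + 1) ^ d') :=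
        mul_le_mul (h p) (h' p) (abs_nonneg _) ((abs_nonneg _).trans (h p))
    _ = _ := by ring

theorem add (hv : PolyBounded v) (hw : PolyBounded w) : PolyBounded fun p => v p + w p := by
  obtain ⟨C, d, h⟩ := hv
  obtain ⟨C', d', h'⟩ := hw
  refine ⟨|C| + |C'|, d + d', fun p => (abs_add_le _ _).trans ?_⟩
  rw [add_mul]
  have h1 : (1 : ℝ) ≤ (p.1 : ℝ) + p.2 + 1 := by
    have : (0 : ℝ) ≤ (p.1 : ℝ) + p.2 := by positivity
    linarith
  gcongr
  · refine (h p).trans ?_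
    gcongr
    · exact le_abs_self C
    · omega
  · refine (h' p).trans ?_
    gcongr
    · exact le_abs_self C'
    · omega

theorem swap (hw : PolyBounded w) : PolyBounded fun p => w p.swap := by
  obtain ⟨C, d, h⟩ := hw
  refine ⟨C, d, fun p => (h p.swap).trans_eq ?_⟩
  simp [add_comm (p.1 : ℝ)]

theorem degree_pow (i : ℕ) : PolyBounded fun p => ((p.1 : ℝ) + p.2) ^ i := by
  induction i with
  | zero => simpa using const 1
  | succ i ih => simpa only [pow_succ] using ih.mul (fst.add snd)

theorem summable_sq (hw : PolyBounded w) {s t : ℝ} (hs : 0 ≤ s) (ht : 0 ≤ t) (hst : s + t < 1) :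
    Summable fun p => |w p| * appellCoeff p * ((s ^ 2) ^ p.1 * (t ^ 2) ^ p.2) := by
  obtain ⟨C, d, h⟩ := hw
  obtain ⟨q, hq⟩ : ∃ q, q = (s + t) ^ 2 := ⟨_, rfl⟩
  have hq0 : 0 ≤ q := by rw [hq]; positivity
  have hq1 : q < 1 := by rw [hq]; exact pow_lt_one₀ (by positivity) hst (by norm_num)
  have hsum : Summable fun n : ℕ => ((n : ℝ) + 1) ^ d * q ^ n := by
    have h2 : Summable fun n : ℕ => (n : ℝ) ^ d * q ^ n :=
      summable_pow_mul_geometric_of_norm_lt_one d (by rwa [Real.norm_of_nonneg hq0])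
    have h1 : Summable fun n : ℕ => (2 : ℝ) ^ d * ((n : ℝ) ^ d * q ^ n) + 2 ^ d * q ^ n :=
      (h2.mul_left (2 ^ d)).add ((summable_geometric_of_lt_one hq0 hq1).mul_left (2 ^ d))
    refine Summable.of_nonneg_of_le (fun n => by positivity) (fun n => ?_) h1
    rw [← mul_assoc, ← add_mul]
    gcongr
    rcases Nat.eq_zero_or_pos n with rfl | hn
    · have : (1 : ℝ) ≤ 2 ^ d := one_le_pow₀ (by norm_num)
      have h0 : (0 : ℝ) ≤ 2 ^ d * ((0 : ℕ) : ℝ) ^ d := by positivity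
      simp only [Nat.cast_zero, zero_add, one_pow] at *
      linarith
    · have : (1 : ℝ) ≤ n := by exact_mod_cast hn
      have h2 : ((n : ℝ) + 1) ^ d ≤ (2 * n) ^ d := by gcongr; linarith
      rw [mul_pow] at h2
      have : (0 : ℝ) ≤ 2 ^ d := by positivity
      linarith
  have hC : 0 ≤ C := by
    have := (abs_nonneg _).trans (h (0, 0))
    simpa using this
  refine Summable.of_nonneg_of_le (fun p => ?_) (fun p => ?_)
    ((hsum.mul_of_nonneg hsum (fun n => by positivity) (fun n => by positivity)).mul_left C)
  · have := appellCoeff_nonneg p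
    positivity
  · calc _ = |w p| * (appellCoeff p * ((s ^ 2) ^ p.1 * (t ^ 2) ^ p.2)) := by ring
      _ ≤ (C * ((p.1 : ℝ) + p.2 + 1) ^ d) * q ^ (p.1 + p.2) :=
        mul_le_mul (h p) (hq ▸ appellCoeff_mul_le hs ht p)
          (mul_nonneg (appellCoeff_nonneg p) (by positivity)) ((abs_nonneg _).trans (h p))
      _ ≤ (C * (((p.1 : ℝ) + 1) * ((p.2 : ℝ) + 1)) ^ d) * q ^ (p.1 + p.2) := by
        gcongr
        have : (0 : ℝ) ≤ (p.1 : ℝ) * p.2 := by positivity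
        linarith
      _ = _ := by rw [mul_pow, pow_add]; ring

theorem summable (hw : PolyBounded w) {X Y : ℝ} (h : √|X| + √|Y| < 1) :
    Summable fun p => w p * appellCoeff p * (X ^ p.1 * Y ^ p.2) := by
  refine Summable.of_norm ?_
  convert hw.summable_sq (Real.sqrt_nonneg _) (Real.sqrt_nonneg _) h using 2 with p
  rw [Real.sq_sqrt (abs_nonneg _), Real.sq_sqrt (abs_nonneg _)]
  simp [abs_of_nonneg (appellCoeff_nonneg p)]

end PolyBounded

/-- The double series `∑ w(m,n) (1/4)_{m+n} (3/4)_{m+n} / (m!^2 n!^2) X^m Y^n` of Appell type at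
`X = α (1 - β)`, `Y = β (1 - α)`. -/
noncomputable def appellSeries (w : ℕ × ℕ → ℝ) (α β : ℝ) : ℝ :=
  ∑' p : ℕ × ℕ, w p * appellCoeff p * ((α * (1 - β)) ^ p.1 * (β * (1 - α)) ^ p.2)

/-- The region of absolute convergence of `appellSeries`. -/
def AppellConv (α β : ℝ) : Prop := √|α * (1 - β)| + √|β * (1 - α)| < 1

theorem AppellConv.symm {α β : ℝ} (h : AppellConv α β) : AppellConv β α := by
  unfold AppellConv at *
  linarith

theorem appellConv_of_add_lt_one {α β : ℝ} (hα : 0 ≤ α) (hβ : 0 ≤ β) (h : α + β < 1) :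
    AppellConv α β := by
  have hX : 0 ≤ α * (1 - β) := mul_nonneg hα (by linarith)
  have hY : 0 ≤ β * (1 - α) := mul_nonneg hβ (by linarith)
  unfold AppellConv
  rw [abs_of_nonneg hX, abs_of_nonneg hY]
  have hx := Real.sq_sqrt hX
  have hy := Real.sq_sqrt hY
  have hx0 := Real.sqrt_nonneg (α * (1 - β))
  have hy0 := Real.sqrt_nonneg (β * (1 - α))
  generalize √(α * (1 - β)) = s at *
  generalize √(β * (1 - α)) = t at *
  have hαβ : 0 ≤ α * β := mul_nonneg hα hβ
  have h1 : 2 * (s * t) < (1 - α - β) + 2 * (α * β) := by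
    refine lt_of_pow_lt_pow_left₀ 2 (by linarith) ?_
    have h2 : (2 * (s * t)) ^ 2 = 4 * ((α * (1 - β)) * (β * (1 - α))) := by
      rw [← hx, ← hy]; ring
    rw [h2]
    nlinarith [pow_pos (sub_pos.2 h) 2]
  refine lt_of_pow_lt_pow_left₀ 2 (by norm_num) ?_
  nlinarith

theorem appellSeries_swap (w : ℕ × ℕ → ℝ) (α β : ℝ) :
    appellSeries (fun p => w p.swap) α β = appellSeries w β α := by
  unfold appellSeries
  rw [← (Equiv.prodComm ℕ ℕ).tsum_eq]
  refine tsum_congr fun p => ?_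
  simp only [Equiv.prodComm_apply, Prod.swap_swap, appellCoeff_swap, Prod.fst_swap, Prod.snd_swap]
  ring

theorem appellSeries_add {v w : ℕ × ℕ → ℝ} (hv : PolyBounded v) (hw : PolyBounded w) {α β : ℝ}
    (h : AppellConv α β) :
    appellSeries (fun p => v p + w p) α β = appellSeries v α β + appellSeries w α β := by
  unfold appellSeries
  rw [← (hv.summable h).tsum_add (hw.summable h)]
  exact tsum_congr fun p => by ring

theorem appellSeries_const_mul (c : ℝ) (w : ℕ × ℕ → ℝ) (α β : ℝ) :
    appellSeries (fun p => c * w p) α β = c * appellSeries w α β := by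
  unfold appellSeries
  rw [← tsum_mul_left]
  exact tsum_congr fun p => by ring

theorem natCast_mul_pow_pred_mul (m : ℕ) (x : ℝ) : (m : ℝ) * x ^ (m - 1) * x = m * x ^ m := by
  cases m with
  | zero => simp
  | succ m => simp [pow_succ, mul_assoc]

theorem abs_natCast_mul_pow_pred_le {x S : ℝ} (hS : 0 < S) (hx : |x| ≤ S) (m : ℕ) :
    |(m : ℝ) * x ^ (m - 1)| ≤ m * S ^ m / S := by
  rw [le_div_iff₀ hS, ← natCast_mul_pow_pred_mul, abs_mul, abs_pow, Nat.abs_cast]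
  gcongr

theorem exists_hasDerivAt_appellSeries {w : ℕ × ℕ → ℝ} (hw : PolyBounded w) {α β : ℝ}
    (h : AppellConv α β) :
    ∃ d, HasDerivAt (fun a => appellSeries w a β) d α ∧
      α * (1 - α) * d = (1 - α) * appellSeries (fun p => p.1 * w p) α β -
        α * appellSeries (fun p => p.2 * w p) α β := by
  obtain ⟨s, t, hs, ht, hsX, htY, hst⟩ : ∃ s t : ℝ, 0 < s ∧ 0 < t ∧ |α * (1 - β)| < s ^ 2 ∧
      |β * (1 - α)| < t ^ 2 ∧ s + t < 1 := by
    unfold AppellConv at h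
    have h₁ := Real.sqrt_nonneg |α * (1 - β)|
    have h₂ := Real.sqrt_nonneg |β * (1 - α)|
    refine ⟨√|α * (1 - β)| + (1 - √|α * (1 - β)| - √|β * (1 - α)|) / 3,
      √|β * (1 - α)| + (1 - √|α * (1 - β)| - √|β * (1 - α)|) / 3,
      by linarith, by linarith, ?_, ?_, by linarith⟩
    · rw [← Real.sqrt_lt' (by linarith)]; linarith
    · rw [← Real.sqrt_lt' (by linarith)]; linarith
  obtain ⟨ε, hε, hball⟩ : ∃ ε > 0, ∀ a ∈ Metric.ball α ε,
      |a * (1 - β)| < s ^ 2 ∧ |β * (1 - a)| < t ^ 2 := by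
    have h₁ : ∀ᶠ a in nhds α, |a * (1 - β)| < s ^ 2 :=
      (by fun_prop : Continuous fun a => |a * (1 - β)|).continuousAt.eventually_lt_const hsX
    have h₂ : ∀ᶠ a in nhds α, |β * (1 - a)| < t ^ 2 :=
      (by fun_prop : Continuous fun a => |β * (1 - a)|).continuousAt.eventually_lt_const htY
    exact Metric.eventually_nhds_iff_ball.1 (h₁.and h₂)
  have hS : 0 < s ^ 2 := by positivity
  have hT : 0 < t ^ 2 := by positivity
  have hαε : α ∈ Metric.ball α ε := Metric.mem_ball_self hε
  have hv : PolyBounded fun p => w p * ((p.1 : ℝ) * (|1 - β| / s ^ 2) + p.2 * (|β| / t ^ 2)) :=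
    hw.mul ((PolyBounded.fst.mul (.const _)).add (PolyBounded.snd.mul (.const _)))
  refine ⟨_, hasDerivAt_tsum_of_isPreconnected (hv.summable_sq hs.le ht.le hst) Metric.isOpen_ball
    (convex_ball α ε).isPreconnected
    (g' := fun p a => w p * appellCoeff p *
      ((p.1 * (a * (1 - β)) ^ (p.1 - 1)) * (1 - β) * (β * (1 - a)) ^ p.2 -
        (a * (1 - β)) ^ p.1 * ((p.2 * (β * (1 - a)) ^ (p.2 - 1)) * β)))
    ?_ ?_ hαε (hw.summable h) hαε, ?_⟩
  · intro p a _
    have h₁ : HasDerivAt (fun a => (a * (1 - β)) ^ p.1)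
        (p.1 * (a * (1 - β)) ^ (p.1 - 1) * (1 * (1 - β))) a :=
      ((hasDerivAt_id a).mul_const (1 - β)).pow p.1
    have h₂ : HasDerivAt (fun a => (β * (1 - a)) ^ p.2)
        (p.2 * (β * (1 - a)) ^ (p.2 - 1) * (β * -1)) a :=
      (((hasDerivAt_id a).const_sub 1).const_mul β).pow p.2
    exact ((h₁.fun_mul h₂).const_mul (w p * appellCoeff p)).congr_deriv (by ring)
  · intro p a ha
    obtain ⟨hX, hY⟩ := hball a ha
    have hm := abs_natCast_mul_pow_pred_le hS hX.le p.1
    have hn := abs_natCast_mul_pow_pred_le hT hY.le p.2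
    have hX' : |(a * (1 - β)) ^ p.1| ≤ (s ^ 2) ^ p.1 := by rw [abs_pow]; gcongr
    have hY' : |(β * (1 - a)) ^ p.2| ≤ (t ^ 2) ^ p.2 := by rw [abs_pow]; gcongr
    have hT0 := appellCoeff_nonneg p
    rw [Real.norm_eq_abs, abs_mul, abs_mul, abs_of_nonneg hT0, abs_mul (w p),
      abs_of_nonneg (a := (p.1 : ℝ) * (|1 - β| / s ^ 2) + p.2 * (|β| / t ^ 2)) (by positivity)]
    calc _ ≤ |w p| * appellCoeff p * ((p.1 * (s ^ 2) ^ p.1 / s ^ 2) * |1 - β| * (t ^ 2) ^ p.2 +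
          (s ^ 2) ^ p.1 * ((p.2 * (t ^ 2) ^ p.2 / t ^ 2) * |β|)) := by
          refine mul_le_mul_of_nonneg_left ((abs_sub _ _).trans ?_) (by positivity)
          rw [abs_mul, abs_mul _ (1 - β), abs_mul (_ ^ _) (_ * _), abs_mul _ β]
          gcongr
      _ = _ := by ring
  · have hm := (PolyBounded.fst.mul hw).summable h
    have hn := (PolyBounded.snd.mul hw).summable h
    unfold appellSeries
    rw [← tsum_mul_left, ← tsum_mul_left, ← tsum_mul_left,
      ← (hm.mul_left (1 - α)).tsum_sub (hn.mul_left α)]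
    refine tsum_congr fun p => ?_
    have hX := natCast_mul_pow_pred_mul p.1 (α * (1 - β))
    have hY := natCast_mul_pow_pred_mul p.2 (β * (1 - α))
    linear_combination w p * appellCoeff p * (1 - α) * (β * (1 - α)) ^ p.2 * hX -
      w p * appellCoeff p * α * (α * (1 - β)) ^ p.1 * hY

theorem appellSeries_fst_mul_fst {α β : ℝ} :
    appellSeries (fun p => p.1 * p.1) α β = α * (1 - β) *
      appellSeries (fun p => ((p.1 : ℝ) + p.2 + 1 / 4) * ((p.1 : ℝ) + p.2 + 3 / 4)) α β := by
  unfold appellSeries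
  rw [← tsum_mul_left]
  have hinj : Function.Injective fun p : ℕ × ℕ => (p.1 + 1, p.2) := by
    rintro ⟨a, b⟩ ⟨c, d⟩ h
    simpa using h
  rw [← hinj.tsum_eq]
  · refine tsum_congr fun ⟨m, n⟩ => ?_
    have h := appellCoeff_succ_left m n
    simp only at *
    linear_combination (α * (1 - β)) ^ (m + 1) * (β * (1 - α)) ^ n * h
  · rintro ⟨m, n⟩ h
    cases m with
    | zero => simp at h
    | succ m => exact ⟨(m, n), rfl⟩

theorem appellSeries_snd_mul_snd {α β : ℝ} :
    appellSeries (fun p => p.2 * p.2) α β = β * (1 - α) *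
      appellSeries (fun p => ((p.1 : ℝ) + p.2 + 1 / 4) * ((p.1 : ℝ) + p.2 + 3 / 4)) α β := by
  have h := appellSeries_fst_mul_fst (α := β) (β := α)
  rw [← appellSeries_swap, ← appellSeries_swap fun p =>
    ((p.1 : ℝ) + p.2 + 1 / 4) * ((p.1 : ℝ) + p.2 + 3 / 4)] at h
  simpa [add_comm] using h

theorem appellSeries_quadratic {α β : ℝ} (h : AppellConv α β) :
    appellSeries (fun p => ((p.1 : ℝ) + p.2 + 1 / 4) * ((p.1 : ℝ) + p.2 + 3 / 4)) α β =
      appellSeries (fun p => p.1 * p.1) α β + 2 * appellSeries (fun p => p.1 * p.2) α β +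
      appellSeries (fun p => p.2 * p.2) α β + appellSeries (fun p => p.1) α β +
      appellSeries (fun p => p.2) α β + 3 / 16 * appellSeries (fun _ => 1) α β := by
  have hm := PolyBounded.fst
  have hn := PolyBounded.snd
  rw [← appellSeries_const_mul, ← appellSeries_const_mul,
    ← appellSeries_add (hm.mul hm) ((PolyBounded.const 2).mul (hm.mul hn)) h,
    ← appellSeries_add _ (hn.mul hn) h, ← appellSeries_add _ hm h, ← appellSeries_add _ hn h,
    ← appellSeries_add _ ((PolyBounded.const _).mul (.const _)) h]
  · congr 1
    ext p
    ring
  · exact ((((hm.mul hm).add ((PolyBounded.const 2).mul (hm.mul hn))).add (hn.mul hn)).add hm).add hn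
  · exact (((hm.mul hm).add ((PolyBounded.const 2).mul (hm.mul hn))).add (hn.mul hn)).add hm
  · exact ((hm.mul hm).add ((PolyBounded.const 2).mul (hm.mul hn))).add (hn.mul hn)
  · exact (hm.mul hm).add ((PolyBounded.const 2).mul (hm.mul hn))

/-- The value of `α (1 - α) ∂/∂α` on `appellSeries w`. -/
noncomputable def appellFlow (w : ℕ × ℕ → ℝ) (α β : ℝ) : ℝ :=
  (1 - α) * appellSeries (fun p => p.1 * w p) α β - α * appellSeries (fun p => p.2 * w p) α β

theorem hasDerivAt_appellSeries {w : ℕ × ℕ → ℝ} (hw : PolyBounded w) {α β : ℝ}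
    (h : AppellConv α β) (hα : α * (1 - α) ≠ 0) :
    HasDerivAt (fun a => appellSeries w a β) (appellFlow w α β / (α * (1 - α))) α := by
  obtain ⟨d, hd, e⟩ := exists_hasDerivAt_appellSeries hw h
  rwa [appellFlow, ← e, mul_div_cancel_left₀ _ hα]

theorem continuousAt_appellSeries {w : ℕ × ℕ → ℝ} (hw : PolyBounded w) {α β : ℝ}
    (h : AppellConv α β) : ContinuousAt (fun a => appellSeries w a β) α :=
  let ⟨_, hd, _⟩ := exists_hasDerivAt_appellSeries hw h
  hd.continuousAt

/-- The hypergeometric differential equation in `α`. -/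
theorem hasDerivAt_appellFlow {α β : ℝ} (h : AppellConv α β) (hα : α * (1 - α) ≠ 0) :
    HasDerivAt (fun a => appellFlow (fun _ => 1) a β) (3 / 16 * appellSeries (fun _ => 1) α β)
      α := by
  unfold appellFlow
  simp only [mul_one]
  have hm := hasDerivAt_appellSeries PolyBounded.fst h hα
  have hn := hasDerivAt_appellSeries PolyBounded.snd h hα
  have h₁ := (((hasDerivAt_id α).const_sub 1).fun_mul hm).fun_sub ((hasDerivAt_id α).fun_mul hn)
  refine h₁.congr_deriv ?_
  have e₁ := appellSeries_fst_mul_fst (α := α) (β := β)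
  have e₂ := appellSeries_snd_mul_snd (α := α) (β := β)
  have e₃ := appellSeries_quadratic h
  have e₄ : appellSeries (fun p => p.2 * p.1) α β = appellSeries (fun p => p.1 * p.2) α β := by
    simp only [mul_comm]
  unfold appellFlow
  simp only [id]
  rw [e₄]
  obtain ⟨h0, h1⟩ := mul_ne_zero_iff.1 hα
  generalize appellSeries (fun p => p.1 * p.1) α β = mm at *
  generalize appellSeries (fun p => p.1 * p.2) α β = mn at *
  generalize appellSeries (fun p => p.2 * p.2) α β = nn at *
  generalize appellSeries (fun p => p.1) α β = m at *
  generalize appellSeries (fun p => p.2) α β = n at *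
  generalize appellSeries (fun _ => 1) α β = o at *
  generalize appellSeries (fun p => ((p.1 : ℝ) + p.2 + 1 / 4) * _) α β = q at *
  subst e₁ e₂
  clear h₁ hm hn
  rw [← sub_eq_zero]
  field_simp
  linear_combination (16 : ℝ) * e₃

/-- The hypergeometric function `₂F₁(1/4, 3/4; 1; t)`. -/
noncomputable def hyper (t : ℝ) : ℝ := appellSeries (fun _ => 1) t 0

/-- The function `t (1 - t) d/dt ₂F₁(1/4, 3/4; 1; t)`. -/
noncomputable def hyperFlow (t : ℝ) : ℝ := appellFlow (fun _ => 1) t 0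

theorem appellConv_zero_right {t : ℝ} (h₀ : 0 ≤ t) (h₁ : t < 1) : AppellConv t 0 :=
  appellConv_of_add_lt_one h₀ le_rfl (by linarith)

theorem appellSeries_zero_right (w : ℕ × ℕ → ℝ) (t : ℝ) :
    appellSeries w t 0 = ∑' n : ℕ, w (n, 0) * quarterCoeff n * t ^ n := by
  unfold appellSeries
  have hinj : Function.Injective fun n : ℕ => (n, 0) := Prod.mk_left_injective 0
  rw [← hinj.tsum_eq]
  · exact tsum_congr fun n => by simp [appellCoeff]
  · rintro ⟨m, n⟩ h
    cases n with
    | zero => exact ⟨m, rfl⟩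
    | succ n => simp at h

theorem appellSeries_zero_left (w : ℕ × ℕ → ℝ) (t : ℝ) :
    appellSeries w 0 t = ∑' n : ℕ, w (0, n) * quarterCoeff n * t ^ n := by
  rw [← appellSeries_swap, appellSeries_zero_right]
  rfl

theorem summable_quarterCoeff_mul_pow {t : ℝ} (h₀ : 0 ≤ t) (h₁ : t < 1) :
    Summable fun n => quarterCoeff n * t ^ n :=
  Summable.of_nonneg_of_le (fun n => mul_nonneg (quarterCoeff_nonneg n) (by positivity))
    (fun n => mul_le_of_le_one_left (by positivity) (quarterCoeff_le_one n))
    (summable_geometric_of_lt_one h₀ h₁)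

theorem hyper_eq_tsum (t : ℝ) : hyper t = ∑' n : ℕ, quarterCoeff n * t ^ n := by
  simp [hyper, appellSeries_zero_right]

theorem hyperFlow_eq_tsum (t : ℝ) :
    hyperFlow t = (1 - t) * ∑' n : ℕ, n * quarterCoeff n * t ^ n := by
  simp [hyperFlow, appellFlow, appellSeries_zero_right]

theorem hyper_pos {t : ℝ} (h₀ : 0 ≤ t) (h₁ : t < 1) : 0 < hyper t := by
  rw [hyper_eq_tsum]
  refine (summable_quarterCoeff_mul_pow h₀ h₁).tsum_pos
    (fun n => mul_nonneg (quarterCoeff_nonneg n) (by positivity)) 0 ?_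
  simp [quarterCoeff_zero]

theorem hyper_zero : hyper 0 = 1 := by
  rw [hyper_eq_tsum, tsum_eq_single 0 fun n hn => by simp [hn]]
  simp [quarterCoeff_zero]

theorem hasDerivAt_hyper {t : ℝ} (h₀ : 0 < t) (h₁ : t < 1) :
    HasDerivAt hyper (hyperFlow t / (t * (1 - t))) t :=
  hasDerivAt_appellSeries (.const 1) (appellConv_zero_right h₀.le h₁)
    (mul_pos h₀ (sub_pos.2 h₁)).ne'

theorem hasDerivAt_hyperFlow {t : ℝ} (h₀ : 0 < t) (h₁ : t < 1) :
    HasDerivAt hyperFlow (3 / 16 * hyper t) t :=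
  hasDerivAt_appellFlow (appellConv_zero_right h₀.le h₁) (mul_pos h₀ (sub_pos.2 h₁)).ne'

theorem continuousAt_appellFlow {w : ℕ × ℕ → ℝ} (hw : PolyBounded w) {α β : ℝ}
    (h : AppellConv α β) : ContinuousAt (fun a => appellFlow w a β) α := by
  unfold appellFlow
  exact ((continuousAt_const.sub continuousAt_id).mul
    (continuousAt_appellSeries (PolyBounded.fst.mul hw) h)).sub
    (continuousAt_id.mul (continuousAt_appellSeries (PolyBounded.snd.mul hw) h))

theorem appellFlow_one_zero_left (β : ℝ) : appellFlow (fun _ => 1) 0 β = 0 := by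
  simp [appellFlow, appellSeries_zero_left]

theorem eq_of_hasDerivAt_zero {f : ℝ → ℝ} {a b : ℝ} (hab : a ≤ b)
    (hc : ContinuousOn f (Set.Icc a b)) (hd : ∀ x ∈ Set.Ioo a b, HasDerivAt f 0 x) :
    f b = f a := by
  rcases hab.eq_or_lt with rfl | hab
  · rfl
  obtain ⟨c, _, hc⟩ := exists_hasDerivAt_eq_slope f (fun _ => 0) hab hc hd
  rw [eq_div_iff (sub_pos.2 hab).ne', zero_mul] at hc
  linarith

/-- Bailey's factorisation of the Appell series. -/
theorem appellSeries_eq_hyper_mul_hyper {α β : ℝ} (hα : 0 ≤ α) (hβ : 0 ≤ β) (h : α + β < 1) :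
    appellSeries (fun _ => 1) α β = hyper α * hyper β := by
  have hconv : ∀ a ∈ Set.Icc 0 α, AppellConv a β := fun a ha =>
    appellConv_of_add_lt_one ha.1 hβ (by linarith [ha.2])
  have hconv₀ : ∀ a ∈ Set.Icc 0 α, AppellConv a 0 := fun a ha =>
    appellConv_zero_right ha.1 (by linarith [ha.2])
  have hne : ∀ a ∈ Set.Ioo 0 α, a * (1 - a) ≠ 0 := fun a ha =>
    (mul_pos ha.1 (by linarith [ha.2])).ne'
  have hsub : ∀ {a}, a ∈ Set.Ioo 0 α → a ∈ Set.Icc 0 α := fun ha => Set.Ioo_subset_Icc_self ha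
  have hcF : ContinuousOn (fun a => appellSeries (fun _ => 1) a β) (Set.Icc 0 α) := fun a ha =>
    (continuousAt_appellSeries (.const 1) (hconv a ha)).continuousWithinAt
  have hcU : ContinuousOn hyper (Set.Icc 0 α) := fun a ha =>
    (continuousAt_appellSeries (.const 1) (hconv₀ a ha)).continuousWithinAt
  have hwronskian : ∀ b ∈ Set.Icc 0 α, appellFlow (fun _ => 1) b β * hyper b -
      appellSeries (fun _ => 1) b β * hyperFlow b = 0 := by
    intro b hb
    have hIcc : Set.Icc 0 b ⊆ Set.Icc 0 α := Set.Icc_subset_Icc_right hb.2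
    have hIoo : Set.Ioo 0 b ⊆ Set.Ioo 0 α := Set.Ioo_subset_Ioo_right hb.2
    have := eq_of_hasDerivAt_zero (f := fun b => appellFlow (fun _ => 1) b β * hyper b -
      appellSeries (fun _ => 1) b β * hyperFlow b) hb.1 ?_ ?_
    · rw [this, appellFlow_one_zero_left, hyperFlow, appellFlow_one_zero_left]
      ring
    · refine ContinuousOn.sub (.mul ?_ (hcU.mono hIcc)) ((hcF.mono hIcc).mul ?_)
      · exact fun a ha =>
          (continuousAt_appellFlow (.const 1) (hconv a (hIcc ha))).continuousWithinAt
      · exact fun a ha =>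
          (continuousAt_appellFlow (.const 1) (hconv₀ a (hIcc ha))).continuousWithinAt
    · intro a ha
      replace ha := hIoo ha
      have h₁ := hasDerivAt_appellSeries (.const 1) (hconv a (hsub ha)) (hne a ha)
      have h₂ := hasDerivAt_appellFlow (hconv a (hsub ha)) (hne a ha)
      have h₃ := hasDerivAt_hyper ha.1 (by linarith [ha.2])
      have h₄ := hasDerivAt_hyperFlow ha.1 (by linarith [ha.2])
      exact ((h₂.fun_mul h₃).fun_sub (h₁.fun_mul h₄)).congr_deriv (by ring)
  have hpos : ∀ a ∈ Set.Icc 0 α, hyper a ≠ 0 := fun a ha =>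
    (hyper_pos ha.1 (by linarith [ha.2])).ne'
  have key := eq_of_hasDerivAt_zero (f := fun a => appellSeries (fun _ => 1) a β / hyper a) hα
    (hcF.div hcU hpos) ?_
  · simp only [hyper_zero, div_one] at key
    rw [div_eq_iff (hpos α ⟨hα, le_rfl⟩)] at key
    rw [key, mul_comm, ← appellSeries_swap]
    rfl
  · intro a ha
    have h₁ := hasDerivAt_appellSeries (.const 1) (hconv a (hsub ha)) (hne a ha)
    have h₃ := hasDerivAt_hyper ha.1 (by linarith [ha.2])
    refine (h₁.fun_div h₃ (hpos a (hsub ha))).congr_deriv ?_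
    have := hwronskian a (hsub ha)
    rw [div_mul_eq_mul_div, mul_div_assoc', ← sub_div, this]
    simp

/-- If `appellSeries w` agrees with `f` on the open triangle, then the Euler operator applied to
`appellSeries w` is computed from the partial derivatives of `f`. -/
theorem appellSeries_degree_mul {w : ℕ × ℕ → ℝ} (hw : PolyBounded w) {f : ℝ → ℝ → ℝ}
    (hf : ∀ a b, 0 < a → 0 < b → a + b < 1 → appellSeries w a b = f a b) {α β d e : ℝ}
    (hα : 0 < α) (hβ : 0 < β) (h : α + β < 1)
    (hd : HasDerivAt (fun a => f a β) (d / (α * (1 - α))) α)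
    (he : HasDerivAt (fun b => f α b) (e / (β * (1 - β))) β) :
    appellSeries (fun p => (p.1 + p.2) * w p) α β = (d + e) / (1 - α - β) := by
  have hconv := appellConv_of_add_lt_one hα.le hβ.le h
  have hα' : α * (1 - α) ≠ 0 := (mul_pos hα (by linarith)).ne'
  have hβ' : β * (1 - β) ≠ 0 := (mul_pos hβ (by linarith)).ne'
  have h₁ := hasDerivAt_appellSeries hw hconv hα'
  have h₂ := hasDerivAt_appellSeries hw.swap hconv.symm hβ'
  have e₁ : (fun a => appellSeries w a β) =ᶠ[nhds α] fun a => f a β := by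
    filter_upwards [Ioo_mem_nhds hα (lt_sub_iff_add_lt.2 h)] with a ha
    exact hf a β ha.1 hβ (by linarith [ha.2])
  have e₂ : (fun b => appellSeries (fun p => w p.swap) b α) =ᶠ[nhds β] fun b => f α b := by
    filter_upwards [Ioo_mem_nhds hβ (lt_sub_iff_add_lt'.2 h)] with b hb
    rw [appellSeries_swap]
    exact hf α b hα hb.1 (by linarith [hb.2])
  have k₁ := (hd.congr_of_eventuallyEq e₁).unique h₁
  have k₂ := (he.congr_of_eventuallyEq e₂).unique h₂
  rw [div_left_inj' hα'] at k₁
  rw [div_left_inj' hβ'] at k₂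
  have s₁ : appellSeries (fun p => p.1 * w p.swap) β α = appellSeries (fun p => p.2 * w p) α β :=
    (appellSeries_swap (fun p => p.2 * w p) β α)
  have s₂ : appellSeries (fun p => p.2 * w p.swap) β α = appellSeries (fun p => p.1 * w p) α β :=
    (appellSeries_swap (fun p => p.1 * w p) β α)
  rw [k₁, k₂, appellFlow, appellFlow, s₁, s₂, eq_div_iff (by linarith)]
  have := appellSeries_add (PolyBounded.fst.mul hw) (PolyBounded.snd.mul hw) hconv
  simp only [add_mul]
  rw [this]
  ring

section ClosedForms

variable {α β : ℝ}

theorem appellSeries_degree (hα : 0 < α) (hβ : 0 < β) (h : α + β < 1) :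
    appellSeries (fun p => ((p.1 : ℝ) + p.2) ^ 1) α β =
      (hyperFlow α * hyper β + hyper α * hyperFlow β) / (1 - α - β) := by
  have := appellSeries_degree_mul (.const 1) (f := fun a b => hyper a * hyper b)
    (fun a b ha hb hab => appellSeries_eq_hyper_mul_hyper ha.le hb.le hab) hα hβ h
    (((hasDerivAt_hyper hα (by linarith)).mul_const (hyper β)).congr_deriv
      (div_mul_eq_mul_div _ _ _))
    (((hasDerivAt_hyper hβ (by linarith)).const_mul (hyper α)).congr_deriv
      (mul_div_assoc _ _ _).symm)
  simpa using this

theorem hasDerivAt_degree_closed_form (hα : 0 < α) (hβ : 0 < β) (h : α + β < 1) :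
    HasDerivAt (fun a => (hyperFlow a * hyper β + hyper a * hyperFlow β) / (1 - a - β))
      (((3 / 16 * (α * (1 - α)) * hyper α * hyper β + hyperFlow α * hyperFlow β) / (1 - α - β) +
        α * (1 - α) * (hyperFlow α * hyper β + hyper α * hyperFlow β) / (1 - α - β) ^ 2) /
        (α * (1 - α))) α := by
  have h1 : 0 < 1 - α := by linarith
  have hρ : 1 - α - β ≠ 0 := by linarith
  have hu := hasDerivAt_hyper hα (by linarith)
  have hv := hasDerivAt_hyperFlow hα (by linarith)
  refine (((hv.mul_const (hyper β)).fun_add (hu.mul_const (hyperFlow β))).fun_div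
    (((hasDerivAt_id α).const_sub 1).sub_const β) hρ).congr_deriv ?_
  simp only [id]
  field_simp
  ring

theorem appellSeries_degree_sq (hα : 0 < α) (hβ : 0 < β) (h : α + β < 1) :
    appellSeries (fun p => ((p.1 : ℝ) + p.2) ^ 2) α β =
      (3 / 16 * (α * (1 - α) + β * (1 - β)) * (hyper α * hyper β) +
        2 * (hyperFlow α * hyperFlow β)) / (1 - α - β) ^ 2 +
      (α * (1 - α) + β * (1 - β)) * (hyperFlow α * hyper β + hyper α * hyperFlow β) /
        (1 - α - β) ^ 3 := by
  have hd := hasDerivAt_degree_closed_form hα hβ h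
  have he := hasDerivAt_degree_closed_form hβ hα (by linarith)
  have key := appellSeries_degree_mul (PolyBounded.degree_pow 1)
    (f := fun a b => (hyperFlow a * hyper b + hyper a * hyperFlow b) / (1 - a - b))
    (fun a b ha hb hab => appellSeries_degree ha hb hab) hα hβ h hd
    (he.congr_of_eventuallyEq (.of_forall fun b => by
      dsimp only
      rw [sub_right_comm 1 b α]
      ring))
  simp only [← pow_succ', one_add_one_eq_two] at key
  rw [key]
  have hρ : 1 - α - β ≠ 0 := by linarith
  rw [sub_right_comm 1 β α]
  field_simp
  ring

theorem hasDerivAt_degree_sq_closed_form (hα : 0 < α) (hβ : 0 < β) (h : α + β < 1) :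
    HasDerivAt (fun a => (3 / 16 * (a * (1 - a) + β * (1 - β)) * (hyper a * hyper β) +
        2 * (hyperFlow a * hyperFlow β)) / (1 - a - β) ^ 2 +
      (a * (1 - a) + β * (1 - β)) * (hyperFlow a * hyper β + hyper a * hyperFlow β) /
        (1 - a - β) ^ 3)
      (((3 / 16 * (α * (1 - α) * (1 - 2 * α) * (hyper α * hyper β) +
          (α * (1 - α) + β * (1 - β)) * (hyperFlow α * hyper β) +
          2 * (α * (1 - α)) * (hyper α * hyperFlow β))) / (1 - α - β) ^ 2 +
        2 * (α * (1 - α)) * (3 / 16 * (α * (1 - α) + β * (1 - β)) * (hyper α * hyper β) +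
          2 * (hyperFlow α * hyperFlow β)) / (1 - α - β) ^ 3 +
        (α * (1 - α) * (1 - 2 * α) * (hyperFlow α * hyper β + hyper α * hyperFlow β) +
          (α * (1 - α) + β * (1 - β)) *
            (3 / 16 * (α * (1 - α)) * hyper α * hyper β + hyperFlow α * hyperFlow β)) /
          (1 - α - β) ^ 3 +
        3 * (α * (1 - α)) * (α * (1 - α) + β * (1 - β)) *
          (hyperFlow α * hyper β + hyper α * hyperFlow β) / (1 - α - β) ^ 4) /
        (α * (1 - α))) α := by
  have h1 : 0 < 1 - α := by linarith
  have hρ : 1 - α - β ≠ 0 := by linarith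
  have hu := hasDerivAt_hyper hα (by linarith)
  have hv := hasDerivAt_hyperFlow hα (by linarith)
  have hr := ((hasDerivAt_id α).const_sub 1).sub_const β
  have hσ := ((hasDerivAt_id α).fun_mul ((hasDerivAt_id α).const_sub 1)).add_const (β * (1 - β))
  refine ((((hσ.const_mul (3 / 16)).fun_mul (hu.mul_const (hyper β))).fun_add
      ((hv.mul_const (hyperFlow β)).const_mul 2)).fun_div (hr.fun_pow 2) (pow_ne_zero 2 hρ)
    |>.fun_add ((hσ.fun_mul ((hv.mul_const (hyper β)).fun_add
      (hu.mul_const (hyperFlow β)))).fun_div (hr.fun_pow 3) (pow_ne_zero 3 hρ))).congr_deriv ?_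
  simp only [id]
  generalize 1 - α - β = r at *
  field_simp
  ring

theorem appellSeries_degree_cube (hα : 0 < α) (hβ : 0 < β) (h : α + β < 1) :
    appellSeries (fun p => ((p.1 : ℝ) + p.2) ^ 3) α β =
      (3 * (α * (1 - α) + β * (1 - β)) ^ 2 / (1 - α - β) ^ 5 +
        (α * (1 - α) * (1 - 2 * α) + β * (1 - β) * (1 - 2 * β)) / (1 - α - β) ^ 4) *
        (hyperFlow α * hyper β + hyper α * hyperFlow β) +
      3 * (α * (1 - α) + β * (1 - β)) / (1 - α - β) ^ 4 *
        (3 / 16 * (α * (1 - α) + β * (1 - β)) * (hyper α * hyper β) +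
          2 * (hyperFlow α * hyperFlow β)) +
      3 / 16 * ((α * (1 - α) * (1 - 2 * α) + β * (1 - β) * (1 - 2 * β)) * (hyper α * hyper β) +
        (α * (1 - α) + β * (1 - β)) * (hyperFlow α * hyper β + hyper α * hyperFlow β) +
        2 * (α * (1 - α) * (hyper α * hyperFlow β) + β * (1 - β) * (hyperFlow α * hyper β))) /
        (1 - α - β) ^ 3 := by
  have hd := hasDerivAt_degree_sq_closed_form hα hβ h
  have he := hasDerivAt_degree_sq_closed_form hβ hα (by linarith)
  have key := appellSeries_degree_mul (PolyBounded.degree_pow 2)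
    (f := fun a b => (3 / 16 * (a * (1 - a) + b * (1 - b)) * (hyper a * hyper b) +
        2 * (hyperFlow a * hyperFlow b)) / (1 - a - b) ^ 2 +
      (a * (1 - a) + b * (1 - b)) * (hyperFlow a * hyper b + hyper a * hyperFlow b) /
        (1 - a - b) ^ 3)
    (fun a b ha hb hab => appellSeries_degree_sq ha hb hab) hα hβ h hd
    (he.congr_of_eventuallyEq (.of_forall fun b => by
      dsimp only
      rw [sub_right_comm 1 b α]
      ring))
  simp only [← pow_succ', show 2 + 1 = 3 from rfl] at key
  rw [key]
  have hρ : 1 - α - β ≠ 0 := by linarith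
  rw [sub_right_comm 1 β α]
  generalize 1 - α - β = r at *
  field_simp
  ring

end ClosedForms

theorem poch_eq_prod (a : ℝ) (n : ℕ) : poch a n = ∏ j ∈ Finset.range n, (a + j) := by
  induction n with
  | zero => simp [poch_zero]
  | succ n ih => rw [poch_succ, Finset.prod_range_succ, ih]

theorem tendsto_natCast_mul_quarterCoeff :
    Tendsto (fun n : ℕ => n * quarterCoeff n) atTop (nhds (1 / (√2 * π))) := by
  rw [← tendsto_add_atTop_iff_nat 1]
  have hG := (Real.GammaSeq_tendsto_Gamma (1 / 4)).mul (Real.GammaSeq_tendsto_Gamma (1 - 1 / 4))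
  rw [Real.Gamma_mul_Gamma_one_sub, show π * (1 / 4) = π / 4 by ring, Real.sin_pi_div_four] at hG
  have hne : π / (√2 / 2) ≠ 0 := by positivity
  have h2 : (√2 : ℝ) ^ 2 = 2 := Real.sq_sqrt (by norm_num)
  have hlim : 1 / (√2 * π) = 1 / (π / (√2 / 2)) := by
    field_simp
    linarith
  rw [hlim, ← one_mul (1 / (π / (√2 / 2)))]
  refine (tendsto_natCast_div_add_atTop (1 : ℝ)).mul (tendsto_const_nhds.div hG hne) |>.congr' ?_
  filter_upwards [eventually_ge_atTop 1] with n hn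
  have hn0 : (0 : ℝ) < n := by exact_mod_cast hn
  have hp : ∀ a : ℝ, 0 < a → 0 < poch a (n + 1) := fun a ha => by
    rw [poch_eq_prod]
    exact Finset.prod_pos fun j _ => by positivity
  have hp₁ := hp (1 / 4) (by norm_num)
  have hp₂ := hp (3 / 4) (by norm_num)
  have hf : (0 : ℝ) < n.factorial := by positivity
  have hpow : (n : ℝ) ^ (1 / 4 : ℝ) * (n : ℝ) ^ (3 / 4 : ℝ) = n := by
    rw [← Real.rpow_add hn0]
    norm_num
  change (n : ℝ) / (n + 1) *
    (1 / (Real.GammaSeq (1 / 4) n * Real.GammaSeq (1 - 1 / 4) n)) = _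
  rw [Real.GammaSeq, Real.GammaSeq, ← poch_eq_prod, ← poch_eq_prod, quarterCoeff,
    Nat.factorial_succ, show (1 - 1 / 4 : ℝ) = 3 / 4 by norm_num]
  push_cast
  have hX : (n : ℝ) ^ (1 / 4 : ℝ) * n.factorial / poch (1 / 4) (n + 1) *
      ((n : ℝ) ^ (3 / 4 : ℝ) * n.factorial / poch (3 / 4) (n + 1)) =
      n * (n.factorial : ℝ) ^ 2 / (poch (1 / 4) (n + 1) * poch (3 / 4) (n + 1)) := by
    rw [div_mul_div_comm]
    congr 1
    linear_combination (n.factorial : ℝ) ^ 2 * hpow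
  rw [hX]
  field_simp

theorem tendsto_quarterCoeff : Tendsto quarterCoeff atTop (nhds 0) := by
  have h := tendsto_natCast_mul_quarterCoeff.mul (tendsto_one_div_atTop_nhds_zero_nat (𝕜 := ℝ))
  rw [mul_zero] at h
  refine h.congr' ?_
  filter_upwards [eventually_ge_atTop 1] with n hn
  have hn0 : (n : ℝ) ≠ 0 := by positivity
  field_simp

theorem tendsto_one_sub_mul_tsum {b : ℕ → ℝ} {l : ℝ} (hb : Tendsto b atTop (nhds l)) :
    Tendsto (fun t => (1 - t) * ∑' n, b n * t ^ n) (nhdsWithin 1 (Set.Iio 1)) (nhds l) := by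
  let f : ℕ → ℝ := fun n => b n - if n = 0 then 0 else b (n - 1)
  have hf : Tendsto (fun n => ∑ i ∈ Finset.range n, f i) atTop (nhds l) := by
    rw [← tendsto_add_atTop_iff_nat 1]
    refine hb.congr fun n => ?_
    induction n with
    | zero => simp [f]
    | succ n ih => rw [Finset.sum_range_succ, ← ih]; simp [f]
  refine (Real.tendsto_tsum_powerSeries_nhdsWithin_lt hf).congr' ?_
  filter_upwards [Ioo_mem_nhdsLT (zero_lt_one' ℝ)] with t ht
  have hs : Summable fun n => b n * t ^ n := by
    refine summable_of_isBigO_nat (summable_geometric_of_lt_one ht.1.le ht.2) ?_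
    simpa using (hb.isBigO_one ℝ).mul (Asymptotics.isBigO_refl (fun n : ℕ => t ^ n) atTop)
  have hs' : Summable fun n => (if n = 0 then 0 else b (n - 1)) * t ^ n := by
    rw [← summable_nat_add_iff 1]
    simpa [pow_succ, ← mul_assoc] using hs.mul_right t
  have e : ∑' n, (if n = 0 then 0 else b (n - 1)) * t ^ n = t * ∑' n, b n * t ^ n := by
    rw [hs'.tsum_eq_zero_add, ← tsum_mul_left]
    simp [pow_succ, mul_left_comm, mul_comm]
  simp only [f, sub_mul, one_mul]
  rw [hs.tsum_sub hs', e]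

theorem tendsto_one_sub_mul_hyper :
    Tendsto (fun t => (1 - t) * hyper t) (nhdsWithin 1 (Set.Iio 1)) (nhds 0) := by
  simpa only [hyper_eq_tsum] using tendsto_one_sub_mul_tsum tendsto_quarterCoeff

theorem tendsto_hyperFlow :
    Tendsto hyperFlow (nhdsWithin 1 (Set.Iio 1)) (nhds (1 / (√2 * π))) := by
  have h := tendsto_one_sub_mul_tsum tendsto_natCast_mul_quarterCoeff
  simpa only [← hyperFlow_eq_tsum] using h

section LegendreRelation

variable {k : ℝ}

/-- The argument complementary to `k ^ 2` under the modular parametrisation. -/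
noncomputable def coArg (k : ℝ) : ℝ := ((1 - k) / (1 + 3 * k)) ^ 2

theorem one_sub_coArg (hk0 : 0 < k) :
    1 - coArg k = 8 * k * (1 + k) / (1 + 3 * k) ^ 2 := by
  have : 0 < 1 + 3 * k := by linarith
  unfold coArg
  field_simp
  ring

theorem coArg_pos (hk0 : 0 < k) (hk1 : k < 1) : 0 < coArg k := by
  have h₁ : 0 < 1 + 3 * k := by linarith
  have h₂ : 0 < 1 - k := by linarith
  unfold coArg
  positivity

theorem coArg_lt_one (hk0 : 0 < k) : coArg k < 1 := by
  have : 0 < 1 - coArg k := by rw [one_sub_coArg hk0]; positivity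
  linarith

theorem one_sub_sq_sub_coArg (hk0 : 0 < k) :
    1 - k ^ 2 - coArg k = k * (1 - k) * (8 + 15 * k + 9 * k ^ 2) / (1 + 3 * k) ^ 2 := by
  have : 0 < 1 + 3 * k := by linarith
  unfold coArg
  field_simp
  ring

theorem hasDerivAt_coArg (hk0 : 0 < k) :
    HasDerivAt coArg (-8 * (1 - k) / (1 + 3 * k) ^ 3) k := by
  have h : 0 < 1 + 3 * k := by linarith
  refine (((((hasDerivAt_id k).const_sub 1).fun_div
    (((hasDerivAt_id k).const_mul 3).const_add 1) h.ne')).fun_pow 2).congr_deriv ?_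
  have h' := h.ne'
  simp only [id, Nat.cast_ofNat, Nat.add_one_sub_one, pow_one]
  field_simp
  ring

/-- A Wronskian of the solutions `√(1 + 3k) ₂F₁(k²)` and `₂F₁(coArg k)` of a common
second-order equation in `k`. -/
noncomputable def legendreForm (k : ℝ) : ℝ :=
  3 / 2 * (k * (1 - k ^ 2) / (1 + 3 * k)) * (hyper (k ^ 2) * hyper (coArg k)) +
    2 * (hyperFlow (k ^ 2) * hyper (coArg k)) +
    (1 + 3 * k) * (hyper (k ^ 2) * hyperFlow (coArg k))

theorem hasDerivAt_legendreForm (hk0 : 0 < k) (hk1 : k < 1) :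
    HasDerivAt legendreForm (3 / (2 * (1 + 3 * k)) * legendreForm k) k := by
  have h : 0 < 1 + 3 * k := by linarith
  have h₁ : 0 < 1 - k := by linarith
  have hq0 : 0 < k ^ 2 := by positivity
  have hq1 : k ^ 2 < 1 := pow_lt_one₀ hk0.le hk1 two_ne_zero
  have hsq : HasDerivAt (fun k : ℝ => k ^ 2) (2 * k) k := by simpa using hasDerivAt_pow 2 k
  have hU : HasDerivAt (fun k => hyper (k ^ 2)) (2 * hyperFlow (k ^ 2) / (k * (1 - k ^ 2))) k := by
    refine (HasDerivAt.comp (h₂ := hyper) (h := fun k => k ^ 2) k (hasDerivAt_hyper hq0 hq1)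
      hsq).congr_deriv ?_
    field_simp
  have hU' : HasDerivAt (fun k => hyperFlow (k ^ 2)) (3 / 16 * hyper (k ^ 2) * (2 * k)) k :=
    HasDerivAt.comp (h₂ := hyperFlow) (h := fun k => k ^ 2) k (hasDerivAt_hyperFlow hq0 hq1) hsq
  have hV : HasDerivAt (fun k => hyper (coArg k))
      (-(1 + 3 * k) * hyperFlow (coArg k) / (k * (1 - k ^ 2))) k := by
    refine ((hasDerivAt_hyper (coArg_pos hk0 hk1) (coArg_lt_one hk0)).comp k
      (hasDerivAt_coArg hk0)).congr_deriv ?_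
    rw [one_sub_coArg hk0, show 1 - k ^ 2 = (1 - k) * (1 + k) by ring]
    generalize hyperFlow (coArg k) = v
    unfold coArg
    field_simp
  have hV' : HasDerivAt (fun k => hyperFlow (coArg k))
      (3 / 16 * hyper (coArg k) * (-8 * (1 - k) / (1 + 3 * k) ^ 3)) k :=
    (hasDerivAt_hyperFlow (coArg_pos hk0 hk1) (coArg_lt_one hk0)).comp k (hasDerivAt_coArg hk0)
  have hl := ((hasDerivAt_id k).const_mul 3).const_add 1
  have hc := ((hasDerivAt_id k).fun_mul (hsq.const_sub 1)).fun_div hl h.ne'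
  refine ((((hc.const_mul (3 / 2)).fun_mul (hU.fun_mul hV)).fun_add
    ((hU'.fun_mul hV).const_mul 2)).fun_add (hl.fun_mul (hU.fun_mul hV'))).congr_deriv ?_
  simp only [id, legendreForm]
  generalize hyper (coArg k) = v
  generalize hyperFlow (coArg k) = v'
  generalize hyper (k ^ 2) = u
  generalize hyperFlow (k ^ 2) = u'
  rw [show 1 - k ^ 2 = (1 - k) * (1 + k) by ring]
  field_simp
  ring

theorem hasDerivAt_legendreForm_div_sqrt (hk0 : 0 < k) (hk1 : k < 1) :
    HasDerivAt (fun k => legendreForm k / √(1 + 3 * k)) 0 k := by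
  have h : 0 < 1 + 3 * k := by linarith
  have hs : 0 < √(1 + 3 * k) := Real.sqrt_pos.2 h
  have hd := (((hasDerivAt_id k).const_mul 3).const_add 1).sqrt (by simpa using h.ne')
  refine ((hasDerivAt_legendreForm hk0 hk1).fun_div hd hs.ne').congr_deriv ?_
  simp only [id]
  rw [div_eq_zero_iff]
  left
  have e := Real.sq_sqrt h.le
  field_simp
  rw [e]
  ring

theorem tendsto_coArg : Tendsto coArg (nhdsWithin 0 (Set.Ioi 0)) (nhdsWithin 1 (Set.Iio 1)) := by
  refine tendsto_nhdsWithin_iff.2 ⟨?_, ?_⟩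
  · have hc : ContinuousAt coArg 0 := by
      unfold coArg
      exact (ContinuousAt.div (by fun_prop) (by fun_prop) (by norm_num)).pow 2
    have := hc.tendsto
    rw [show coArg 0 = 1 by norm_num [coArg]] at this
    exact this.mono_left nhdsWithin_le_nhds
  · filter_upwards [self_mem_nhdsWithin] with k hk
    exact coArg_lt_one hk

theorem tendsto_mul_hyper_coArg :
    Tendsto (fun k => k * hyper (coArg k)) (nhdsWithin 0 (Set.Ioi 0)) (nhds 0) := by
  have h₁ := tendsto_one_sub_mul_hyper.comp tendsto_coArg
  have h₂ : Tendsto (fun k : ℝ => (1 + 3 * k) ^ 2 / (8 * (1 + k))) (nhdsWithin 0 (Set.Ioi 0))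
      (nhds ((1 + 3 * 0) ^ 2 / (8 * (1 + 0)))) := by
    have : ContinuousAt (fun k : ℝ => (1 + 3 * k) ^ 2 / (8 * (1 + k))) 0 :=
      ContinuousAt.div (by fun_prop) (by fun_prop) (by norm_num)
    exact this.tendsto.mono_left nhdsWithin_le_nhds
  have h := h₁.mul h₂
  rw [zero_mul] at h
  refine h.congr' ?_
  filter_upwards [self_mem_nhdsWithin] with k hk
  have hk : 0 < k := hk
  simp only [Function.comp_apply]
  rw [one_sub_coArg hk]
  field_simp

theorem tendsto_inv_mul_hyperFlow_sq :
    Tendsto (fun k => k⁻¹ * hyperFlow (k ^ 2)) (nhdsWithin 0 (Set.Ioi 0)) (nhds 0) := by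
  have hconv : AppellConv 0 0 := appellConv_zero_right le_rfl one_pos
  obtain ⟨d, hd, -⟩ := exists_hasDerivAt_appellSeries (PolyBounded.fst.mul (.const 1)) hconv
  obtain ⟨e, he, -⟩ := exists_hasDerivAt_appellSeries (PolyBounded.snd.mul (.const 1)) hconv
  have h := (((hasDerivAt_id (0 : ℝ)).const_sub 1).fun_mul hd).fun_sub
    ((hasDerivAt_id 0).fun_mul he)
  have h' := (HasDerivAt.comp_of_eq (h₂ := hyperFlow) (h := fun k => k ^ 2) 0 h
    (hasDerivAt_pow 2 0) (zero_pow two_ne_zero).symm).tendsto_slope_zero_right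
  have h0 : hyperFlow 0 = 0 := appellFlow_one_zero_left 0
  simpa [h0] using h'

theorem continuousAt_hyper_zero : ContinuousAt hyper 0 :=
  continuousAt_appellSeries (.const 1) (appellConv_zero_right le_rfl one_pos)

theorem tendsto_legendreForm_div_sqrt :
    Tendsto (fun k => legendreForm k / √(1 + 3 * k)) (nhdsWithin 0 (Set.Ioi 0))
      (nhds (1 / (√2 * π))) := by
  have hV := tendsto_mul_hyper_coArg
  have hU' := tendsto_inv_mul_hyperFlow_sq
  have hV' := tendsto_hyperFlow.comp tendsto_coArg
  have hU : Tendsto (fun k : ℝ => hyper (k ^ 2)) (nhdsWithin 0 (Set.Ioi 0)) (nhds 1) := by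
    have : ContinuousAt (fun k : ℝ => hyper (k ^ 2)) 0 :=
      ContinuousAt.comp (g := hyper) (by simpa using continuousAt_hyper_zero) (by fun_prop)
    have := this.tendsto.mono_left (nhdsWithin_le_nhds (s := Set.Ioi 0))
    simpa [hyper_zero] using this
  have hid : Tendsto (fun k : ℝ => k) (nhdsWithin 0 (Set.Ioi 0)) (nhds 0) := nhdsWithin_le_nhds
  have hl : Tendsto (fun k : ℝ => 1 + 3 * k) (nhdsWithin 0 (Set.Ioi 0)) (nhds 1) := by
    simpa using (hid.const_mul 3).const_add 1
  have hc : Tendsto (fun k : ℝ => 3 / 2 * ((1 - k ^ 2) / (1 + 3 * k)))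
      (nhdsWithin 0 (Set.Ioi 0)) (nhds (3 / 2)) := by
    simpa using (((hid.pow 2).const_sub 1).div hl one_ne_zero).const_mul (3 / 2)
  have key := (((hc.mul (hU.mul hV)).add ((hU'.mul hV).const_mul 2)).add
    (hl.mul (hU.mul hV'))).div hl.sqrt (by simp)
  simp only [mul_zero, zero_add, add_zero, one_mul, Real.sqrt_one, div_one] at key
  refine key.congr' ?_
  filter_upwards [self_mem_nhdsWithin] with k hk
  have hk : 0 < k := hk
  simp only [legendreForm, Pi.div_apply, Function.comp_apply]
  congr 1
  field_simp

theorem legendreForm_eq (hk0 : 0 < k) (hk1 : k < 1) :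
    legendreForm k = √(1 + 3 * k) / (√2 * π) := by
  have hs : 0 < √(1 + 3 * k) := Real.sqrt_pos.2 (by linarith)
  suffices h : legendreForm k / √(1 + 3 * k) = 1 / (√2 * π) by
    rw [div_eq_iff hs.ne'] at h
    rw [h]
    ring
  refine tendsto_nhds_unique (tendsto_const_nhds.congr' ?_) tendsto_legendreForm_div_sqrt
  filter_upwards [Ioo_mem_nhdsGT hk0] with j hj
  have hd : ∀ x ∈ Set.Icc j k, HasDerivAt (fun k => legendreForm k / √(1 + 3 * k)) 0 x :=
    fun x hx => hasDerivAt_legendreForm_div_sqrt (hj.1.trans_le hx.1) (hx.2.trans_lt hk1)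
  exact eq_of_hasDerivAt_zero hj.2.le (fun x hx => (hd x hx).continuousAt.continuousWithinAt)
    fun x hx => hd x (Set.Ioo_subset_Icc_self hx)

end LegendreRelation

theorem hasSum_antidiagonal {F : ℕ × ℕ → ℝ} {S : ℝ} (h : HasSum F S) :
    HasSum (fun n => ∑ p ∈ Finset.HasAntidiagonal.antidiagonal n, F p) S := by
  have h' := (Finset.HasAntidiagonal.sigmaAntidiagonalEquivProd (A := ℕ)).hasSum_iff.2 h
  refine h'.sigma fun n => ?_
  rw [← Finset.sum_coe_sort]
  exact hasSum_fintype _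

theorem quarterCoeff_mul_legendreP (n : ℕ) {x z X Y : ℝ} (hX : (x - 1) * z = 2 * X)
    (hY : (x + 1) * z = 2 * Y) :
    quarterCoeff n * legendreP n x * z ^ n =
      ∑ p ∈ Finset.HasAntidiagonal.antidiagonal n, appellCoeff p * (X ^ p.1 * Y ^ p.2) := by
  rw [← Finset.Nat.sum_antidiagonal_swap, Finset.Nat.sum_antidiagonal_eq_sum_range_succ_mk,
    legendreP, mul_comm _ (z ^ n), Finset.mul_sum, Finset.mul_sum, Finset.mul_sum]
  refine Finset.sum_congr rfl fun j hj => ?_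
  obtain ⟨i, rfl⟩ := Nat.exists_eq_add_of_le' (Nat.lt_succ_iff.1 (Finset.mem_range.1 hj))
  have e : X ^ i * Y ^ j = 2⁻¹ ^ (i + j) * (x - 1) ^ i * (x + 1) ^ j * z ^ (i + j) := by
    rw [show X = 2⁻¹ * ((x - 1) * z) by rw [hX]; ring,
      show Y = 2⁻¹ * ((x + 1) * z) by rw [hY]; ring]
    simp only [mul_pow, pow_add]
    ring
  simp only [Prod.swap_prod_mk, appellCoeff, Nat.add_sub_cancel]
  rw [e, Nat.choose_symm_add]
  ring

theorem hasSum_appellSeries {w : ℕ × ℕ → ℝ} (hw : PolyBounded w) {α β : ℝ} (h : AppellConv α β) :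
    HasSum (fun p => w p * appellCoeff p * ((α * (1 - β)) ^ p.1 * (β * (1 - α)) ^ p.2))
      (appellSeries w α β) :=
  (hw.summable h).hasSum

theorem appellSeries_cubic (c₃ c₂ c₁ c₀ : ℝ) {α β : ℝ} (h : AppellConv α β) :
    appellSeries (fun p => c₃ * ((p.1 : ℝ) + p.2) ^ 3 + c₂ * ((p.1 : ℝ) + p.2) ^ 2 +
        c₁ * ((p.1 : ℝ) + p.2) ^ 1 + c₀ * 1) α β =
      c₃ * appellSeries (fun p => ((p.1 : ℝ) + p.2) ^ 3) α β +
        c₂ * appellSeries (fun p => ((p.1 : ℝ) + p.2) ^ 2) α β +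
        c₁ * appellSeries (fun p => ((p.1 : ℝ) + p.2) ^ 1) α β +
        c₀ * appellSeries (fun _ => 1) α β := by
  have h₃ := (PolyBounded.const c₃).mul (.degree_pow 3)
  have h₂ := (PolyBounded.const c₂).mul (.degree_pow 2)
  have h₁ := (PolyBounded.const c₁).mul (.degree_pow 1)
  have h₀ := (PolyBounded.const c₀).mul (.const 1)
  rw [appellSeries_add ((h₃.add h₂).add h₁) h₀ h, appellSeries_add (h₃.add h₂) h₁ h,
    appellSeries_add h₃ h₂ h]
  simp only [appellSeries_const_mul]

theorem appellSeries_eq_legendreForm {k : ℝ} (hk0 : 0 < k) (hk1 : k < 1) :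
    appellSeries (fun p =>
      ((16 * (k - 1) ^ 2 * k ^ 2 / (1 + k) ^ 2) * (8 + 15 * k + 9 * k ^ 2) ^ 2) *
          ((p.1 : ℝ) + p.2) ^ 3 +
        (48 * (k - 1) * k * (8 - 15 * k + 27 * k ^ 2 + 27 * k ^ 3 + 81 * k ^ 4)) *
          ((p.1 : ℝ) + p.2) ^ 2 +
        ((4 - 33 * k + 45 * k ^ 2) * (4 - 17 * k + 17 * k ^ 2 - 3 * k ^ 3 + 63 * k ^ 4)) *
          ((p.1 : ℝ) + p.2) ^ 1 +
        (3 * (1 - 3 * k) ^ 4 * (1 + k + 2 * k ^ 2)) * 1) (k ^ 2) (coArg k) =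
      6 * (1 + 3 * k) ^ 2 * (1 + 3 * k ^ 2) / (1 + k) * legendreForm k := by
  have hl : 0 < 1 + 3 * k := by linarith
  have h1k : 0 < 1 - k := by linarith
  have hα : 0 < k ^ 2 := by positivity
  have hβ := coArg_pos hk0 hk1
  have hρ := one_sub_sq_sub_coArg hk0
  have hαβ : k ^ 2 + coArg k < 1 := by
    have : 0 < 1 - k ^ 2 - coArg k := by rw [hρ]; positivity
    linarith
  rw [appellSeries_cubic _ _ _ _ (appellConv_of_add_lt_one hα.le hβ.le hαβ),
    appellSeries_degree_cube hα hβ hαβ, appellSeries_degree_sq hα hβ hαβ,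
    appellSeries_degree hα hβ hαβ, appellSeries_eq_hyper_mul_hyper hα.le hβ.le hαβ,
    legendreForm, hρ]
  generalize hyper (coArg k) = v
  generalize hyperFlow (coArg k) = v'
  generalize hyper (k ^ 2) = u
  generalize hyperFlow (k ^ 2) = u'
  rw [one_sub_coArg hk0]
  unfold coArg
  have h1k' := h1k.ne'
  have hq : 8 + 15 * k + 9 * k ^ 2 ≠ 0 := by positivity
  field_simp
  ring

theorem stmt10 (k : ℝ) (hk0 : 0 < k) (hk1 : k < 1) (hk : k ≠ 1 / 3) :
    Tendsto (fun N => ∑ n ∈ Finset.range N,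
      (poch (1 / 4) n * poch (3 / 4) n / (n.factorial : ℝ) ^ 2) *
        legendreP n ((1 + k) * (1 - 4 * k + 7 * k ^ 2) / ((1 - 3 * k) * (1 + 3 * k ^ 2))) *
        ((1 + k) * (1 - 3 * k) * (1 + 3 * k ^ 2) / (1 + 3 * k) ^ 2) ^ n *
        ((16 * (k - 1) ^ 2 * k ^ 2 / (1 + k) ^ 2) * (8 + 15 * k + 9 * k ^ 2) ^ 2 * (n : ℝ) ^ 3 +
         48 * (k - 1) * k * (8 - 15 * k + 27 * k ^ 2 + 27 * k ^ 3 + 81 * k ^ 4) * (n : ℝ) ^ 2 +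
         (4 - 33 * k + 45 * k ^ 2) * (4 - 17 * k + 17 * k ^ 2 - 3 * k ^ 3 + 63 * k ^ 4) * (n : ℝ) +
         3 * (1 - 3 * k) ^ 4 * (1 + k + 2 * k ^ 2)))
      atTop (nhds (3 * Real.sqrt 2 * (1 + 3 * k) ^ ((5 : ℝ) / 2) * (1 + 3 * k ^ 2) / ((1 + k) * π))) := by
  have hl : 0 < 1 + 3 * k := by linarith
  have hl' := hl.ne'
  have h13 : 1 - 3 * k ≠ 0 := fun h => hk (by linarith)
  have hα : 0 < k ^ 2 := by positivity
  have hβ := coArg_pos hk0 hk1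
  have hαβ : k ^ 2 + coArg k < 1 := by
    have : 0 < 1 - k ^ 2 - coArg k := by
      have : 0 < 1 - k := by linarith
      rw [one_sub_sq_sub_coArg hk0]
      positivity
    linarith
  have hw := ((((PolyBounded.const
    ((16 * (k - 1) ^ 2 * k ^ 2 / (1 + k) ^ 2) * (8 + 15 * k + 9 * k ^ 2) ^ 2)).mul
      (.degree_pow 3)).add ((PolyBounded.const
    (48 * (k - 1) * k * (8 - 15 * k + 27 * k ^ 2 + 27 * k ^ 3 + 81 * k ^ 4))).mul
      (.degree_pow 2))).add ((PolyBounded.const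
    ((4 - 33 * k + 45 * k ^ 2) * (4 - 17 * k + 17 * k ^ 2 - 3 * k ^ 3 + 63 * k ^ 4))).mul
      (.degree_pow 1))).add ((PolyBounded.const
    (3 * (1 - 3 * k) ^ 4 * (1 + k + 2 * k ^ 2))).mul (.const 1))
  have hs := hasSum_antidiagonal
    (hasSum_appellSeries hw (appellConv_of_add_lt_one hα.le hβ.le hαβ))
  rw [appellSeries_eq_legendreForm hk0 hk1, legendreForm_eq hk0 hk1] at hs
  have hX : ((1 + k) * (1 - 4 * k + 7 * k ^ 2) / ((1 - 3 * k) * (1 + 3 * k ^ 2)) - 1) *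
      ((1 + k) * (1 - 3 * k) * (1 + 3 * k ^ 2) / (1 + 3 * k) ^ 2) =
      2 * (k ^ 2 * (1 - coArg k)) := by
    rw [one_sub_coArg hk0]
    generalize hd : 1 - 3 * k = d at h13
    field_simp
    rw [← hd]
    ring
  have hY : ((1 + k) * (1 - 4 * k + 7 * k ^ 2) / ((1 - 3 * k) * (1 + 3 * k ^ 2)) + 1) *
      ((1 + k) * (1 - 3 * k) * (1 + 3 * k ^ 2) / (1 + 3 * k) ^ 2) =
      2 * (coArg k * (1 - k ^ 2)) := by
    unfold coArg
    generalize hd : 1 - 3 * k = d at h13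
    field_simp
    rw [← hd]
    ring
  convert hs.tendsto_sum_nat using 1
  · ext N
    refine Finset.sum_congr rfl fun n _ => ?_
    rw [← quarterCoeff, quarterCoeff_mul_legendreP n hX hY, Finset.sum_mul]
    refine Finset.sum_congr rfl fun p hp => ?_
    rw [← Finset.HasAntidiagonal.mem_antidiagonal.1 hp]
    push_cast
    ring
  · congr 1
    rw [show (5 : ℝ) / 2 = 2 + 1 / 2 by norm_num, Real.rpow_add hl, ← Real.sqrt_eq_rpow,
      Real.rpow_two]
    have h2 : √2 * √2 = (2 : ℝ) := Real.mul_self_sqrt zero_le_two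
    have := Real.pi_pos
    field_simp
    linear_combination (3 : ℝ) * h2
end
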